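/- If f encodes a smooth embedded paper Moebius band of aspect ratio λ, then λ > √3. -/

import Mathlib

namespace PaperMoebius

open Set Filter Topology
open scoped ContDiff InnerProductSpace

/-- A continuous complex function on a triangle that is `1` on the diagonal and takes opposite
values on the two legs has a zero. -/
theorem exists_zero_of_antisymmetric_legs {F : ℝ × ℝ → ℂ} (hF : Continuous F) {s₀ s₁ : ℝ}
    (h01 : s₀ ≤ s₁) (hdiag : ∀ s ∈ Icc s₀ s₁, F (s, s) = 1)
    (hlegs : ∀ s ∈ Icc s₀ s₁, F (s, s₁) = -F (s₀, s)) :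
    ∃ s t, s₀ ≤ s ∧ s ≤ t ∧ t ≤ s₁ ∧ F (s, t) = 0 := by
  by_contra! hne
  let π : ℝ → ℝ := fun s => max s₀ (min s s₁)
  have hπ : ∀ s, s₀ ≤ π s ∧ π s ≤ s₁ := fun s =>
    ⟨le_max_left _ _, max_le h01 (min_le_right _ _)⟩
  have hπid : ∀ s ∈ Icc s₀ s₁, π s = s := fun s hs => by
    simp only [π]; rw [min_eq_left hs.2, max_eq_right hs.1]
  let G : ℝ × ℝ → ℂ := fun p => F (π p.1, max (π p.1) (π p.2))
  have hGF : ∀ s t, s₀ ≤ s → s ≤ t → t ≤ s₁ → G (s, t) = F (s, t) := fun s t h1 h2 h3 => by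
    simp only [G]
    rw [hπid s ⟨h1, h2.trans h3⟩, hπid t ⟨h1.trans h2, h3⟩, max_eq_right h2]
  have hG : Continuous G := by fun_prop
  have hG0 : ∀ p, G p ≠ 0 := fun p =>
    hne _ _ (hπ p.1).1 (le_max_left _ _) (max_le (hπ p.1).2 (hπ p.2).2)
  have hsc : IsSimplyConnected (univ : Set (ℝ × ℝ)) := by
    have := (convex_univ (𝕜 := ℝ) (E := ℝ × ℝ)).contractibleSpace univ_nonempty
    exact (inferInstance : SimplyConnectedSpace (univ : Set (ℝ × ℝ)))
  obtain ⟨H, hHc, hH⟩ := Complex.exists_continuousOn_pow_eq (X := ℝ × ℝ) (U := univ) (g := G)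
    hsc isOpen_univ hG.continuousOn
    (by rintro ⟨p, -, hp⟩; exact hG0 p hp) two_ne_zero
  have hHc : Continuous H := continuousOn_univ.1 hHc
  have hH0 : ∀ p, H p ≠ 0 := fun p h => hG0 p (by rw [← hH, h]; simp)
  have m0 : s₀ ∈ Icc s₀ s₁ := left_mem_Icc.2 h01
  have m1 : s₁ ∈ Icc s₀ s₁ := right_mem_Icc.2 h01
  have key1 : H (s₁, s₁) = H (s₀, s₀) := by
    have hd : ∀ s ∈ Icc s₀ s₁, H (s, s) ^ 2 = 1 := fun s hs => by
      rw [hH, hGF _ _ hs.1 le_rfl hs.2, hdiag s hs]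
    rcases (isPreconnected_Icc (a := s₀) (b := s₁)).eq_or_eq_neg_of_sq_eq
      (f := fun s => H (s, s)) (g := fun _ => 1)
      (by fun_prop) (by fun_prop) (fun s hs => by simpa using hd s hs) (by simp) with h | h
    · rw [show H (s₁, s₁) = 1 from h m1, show H (s₀, s₀) = 1 from h m0]
    · rw [show H (s₁, s₁) = -1 from h m1, show H (s₀, s₀) = -1 from h m0]
  have key2 : ∀ s ∈ Icc s₀ s₁, H (s, s₁) ^ 2 = (Complex.I * H (s₀, s)) ^ 2 := fun s hs => by
    rw [mul_pow, hH, hH, hGF _ _ hs.1 hs.2 le_rfl, hGF _ _ le_rfl hs.1 hs.2, hlegs s hs]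
    simp
  have key3 : H (s₁, s₁) = -H (s₀, s₀) := by
    rcases (isPreconnected_Icc (a := s₀) (b := s₁)).eq_or_eq_neg_of_sq_eq
      (f := fun s => H (s, s₁)) (g := fun s => Complex.I * H (s₀, s))
      (by fun_prop) (by fun_prop) key2 (fun {s} _ => mul_ne_zero Complex.I_ne_zero (hH0 _))
      with h | h
    · rw [show H (s₁, s₁) = Complex.I * H (s₀, s₁) from h m1,
        show H (s₀, s₁) = Complex.I * H (s₀, s₀) from h m0, ← mul_assoc]
      simp
    · rw [show H (s₁, s₁) = -(Complex.I * H (s₀, s₁)) from h m1,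
        show H (s₀, s₁) = -(Complex.I * H (s₀, s₀)) from h m0, mul_neg, neg_neg, ← mul_assoc]
      simp
  rw [key1] at key3
  exact hH0 (s₀, s₀) (by linear_combination key3 / 2)

section Calculus

variable {V : Type*} [NormedAddCommGroup V] [NormedSpace ℝ V]

/-- The derivative of `G` in the constant direction `v`, as a function of the base point. -/
noncomputable def dirDeriv (v : ℝ × ℝ) (G : ℝ × ℝ → V) : ℝ × ℝ → V := fun p => fderiv ℝ G p v

theorem dirDeriv_contDiff {G : ℝ × ℝ → V} (hG : ContDiff ℝ ∞ G) (v : ℝ × ℝ) :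
    ContDiff ℝ ∞ (dirDeriv v G) :=
  (hG.fderiv_right (m := ∞) (by simp)).clm_apply contDiff_const

theorem dirDeriv_dirDeriv {G : ℝ × ℝ → V} (hG : ContDiff ℝ ∞ G) (v w p : ℝ × ℝ) :
    dirDeriv v (dirDeriv w G) p = fderiv ℝ (fderiv ℝ G) p v w := by
  have hd : Differentiable ℝ (fderiv ℝ G) :=
    (hG.fderiv_right (m := ∞) (by simp)).differentiable (by simp)
  unfold dirDeriv
  rw [fderiv_clm_apply (hd p) (differentiableAt_const w)]
  simp

theorem dirDeriv_comm {G : ℝ × ℝ → V} (hG : ContDiff ℝ ∞ G) (v w : ℝ × ℝ) :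
    dirDeriv v (dirDeriv w G) = dirDeriv w (dirDeriv v G) := by
  funext p
  rw [dirDeriv_dirDeriv hG, dirDeriv_dirDeriv hG]
  exact ((contDiff_infty.1 hG 2).contDiffAt.isSymmSndFDerivAt (by simp)) v w

theorem dirDeriv_neg (v : ℝ × ℝ) (G : ℝ × ℝ → V) : dirDeriv (-v) G = -dirDeriv v G := by
  funext p; simp [dirDeriv]

theorem dirDeriv_neg_neg (v : ℝ × ℝ) (G : ℝ × ℝ → V) :
    dirDeriv (-v) (dirDeriv (-v) G) = dirDeriv v (dirDeriv v G) := by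
  rw [dirDeriv_neg, dirDeriv_neg]
  funext p
  rw [Pi.neg_apply, dirDeriv, fderiv_neg, neg_apply, neg_neg, dirDeriv]

theorem hasDerivAt_line {G : ℝ × ℝ → V} (hG : ContDiff ℝ ∞ G) (p v : ℝ × ℝ) (s : ℝ) :
    HasDerivAt (fun s : ℝ => G (p + s • v)) (dirDeriv v G (p + s • v)) s := by
  have h := (hG.differentiable (by simp) (p + s • v)).hasFDerivAt
  have h2 : HasDerivAt (fun s : ℝ => p + s • v) v s := by
    simpa using ((hasDerivAt_id s).smul_const v).const_add p
  exact h.comp_hasDerivAt s h2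

theorem dirDeriv_congr {G H : ℝ × ℝ → V} {U : Set (ℝ × ℝ)} (hU : IsOpen U)
    (h : ∀ p ∈ U, G p = H p) (v : ℝ × ℝ) : ∀ p ∈ U, dirDeriv v G p = dirDeriv v H p := by
  intro p hp
  unfold dirDeriv
  rw [(eventuallyEq_of_mem (hU.mem_nhds hp) h).fderiv_eq]

theorem dirDeriv_const (c : V) (v : ℝ × ℝ) (p : ℝ × ℝ) : dirDeriv v (fun _ => c) p = 0 := by
  simp [dirDeriv]

theorem dirDeriv_mul {G H : ℝ × ℝ → ℝ} (hG : ContDiff ℝ ∞ G) (hH : ContDiff ℝ ∞ H) (v p : ℝ × ℝ) :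
    dirDeriv v (fun q => G q * H q) p = dirDeriv v G p * H p + G p * dirDeriv v H p := by
  unfold dirDeriv
  rw [fderiv_fun_mul (hG.differentiable (by simp) p) (hH.differentiable (by simp) p)]
  simp; ring

theorem dirDeriv_add {G H : ℝ × ℝ → V} (hG : ContDiff ℝ ∞ G) (hH : ContDiff ℝ ∞ H) (v p : ℝ × ℝ) :
    dirDeriv v (fun q => G q + H q) p = dirDeriv v G p + dirDeriv v H p := by
  unfold dirDeriv
  rw [fderiv_fun_add (hG.differentiable (by simp) p) (hH.differentiable (by simp) p)]
  simp

theorem dirDeriv_inner {W : Type*} [NormedAddCommGroup W] [InnerProductSpace ℝ W]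
    {G H : ℝ × ℝ → W} (hG : ContDiff ℝ ∞ G) (hH : ContDiff ℝ ∞ H) (v p : ℝ × ℝ) :
    dirDeriv v (fun q => ⟪G q, H q⟫_ℝ) p = ⟪dirDeriv v G p, H p⟫_ℝ + ⟪G p, dirDeriv v H p⟫_ℝ := by
  unfold dirDeriv
  rw [fderiv_inner_apply ℝ (hG.differentiable (by simp) p) (hH.differentiable (by simp) p)]
  ring

theorem dirDeriv_inner_const {W : Type*} [NormedAddCommGroup W] [InnerProductSpace ℝ W]
    {G : ℝ × ℝ → W} (hG : ContDiff ℝ ∞ G) (N : W) (v : ℝ × ℝ) :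
    dirDeriv v (fun q => ⟪G q, N⟫_ℝ) = fun q => ⟪dirDeriv v G q, N⟫_ℝ := by
  funext p
  rw [dirDeriv_inner hG contDiff_const, dirDeriv_const]
  simp

end Calculus

/-- Along a line in the kernel direction of the Hessian of a solution of the homogeneous
Monge-Ampère equation, the reciprocal of the transversal second derivative is affine as long as
it is defined. -/
theorem monge_ampere_line_aux {φ : ℝ × ℝ → ℝ} (hφ : ContDiff ℝ ∞ φ) {U : Set (ℝ × ℝ)}
    (hU : IsOpen U) {v w : ℝ × ℝ}
    (hMA : ∀ p ∈ U, dirDeriv v (dirDeriv v φ) p * dirDeriv w (dirDeriv w φ) p =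
      dirDeriv w (dirDeriv v φ) p * dirDeriv w (dirDeriv v φ) p) {p : ℝ × ℝ}
    (h0 : dirDeriv v (dirDeriv v φ) p = 0) :
    ∃ κ : ℝ, ∀ S, 0 ≤ S → (∀ s ∈ Icc 0 S, p + s • v ∈ U) →
      (∀ s ∈ Icc 0 S, dirDeriv w (dirDeriv w φ) (p + s • v) ≠ 0) →
      dirDeriv v (dirDeriv v φ) (p + S • v) = 0 ∧ dirDeriv w (dirDeriv w φ) (p + S • v) *
        ((dirDeriv w (dirDeriv w φ) p)⁻¹ - κ * S) = 1 := by
  set e := dirDeriv v (dirDeriv v φ) with he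
  set m := dirDeriv w (dirDeriv v φ) with hm
  set g := dirDeriv w (dirDeriv w φ) with hg
  have ce : ContDiff ℝ ∞ e := dirDeriv_contDiff (dirDeriv_contDiff hφ _) _
  have cm : ContDiff ℝ ∞ m := dirDeriv_contDiff (dirDeriv_contDiff hφ _) _
  have cg : ContDiff ℝ ∞ g := dirDeriv_contDiff (dirDeriv_contDiff hφ _) _
  have cew := dirDeriv_contDiff ce w
  have cmw := dirDeriv_contDiff cm w
  have cgw := dirDeriv_contDiff cg w
  have hew : dirDeriv w e = dirDeriv v m := dirDeriv_comm (dirDeriv_contDiff hφ _) _ _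
  have hmw : dirDeriv w m = dirDeriv v g := by
    rw [hg, dirDeriv_comm (dirDeriv_contDiff hφ w) v w, dirDeriv_comm hφ v w]
  have id1 : ∀ q ∈ U, dirDeriv w e q * g q + e q * dirDeriv w g q =
      dirDeriv w m q * m q + m q * dirDeriv w m q := fun q hq => by
    have := dirDeriv_congr hU hMA w q hq
    rwa [dirDeriv_mul ce cg, dirDeriv_mul cm cm] at this
  have id2 : ∀ q ∈ U, (dirDeriv w (dirDeriv w e) q * g q + dirDeriv w e q * dirDeriv w g q) +
      (dirDeriv w e q * dirDeriv w g q + e q * dirDeriv w (dirDeriv w g) q) =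
      (dirDeriv w (dirDeriv w m) q * m q + dirDeriv w m q * dirDeriv w m q) +
      (dirDeriv w m q * dirDeriv w m q + m q * dirDeriv w (dirDeriv w m) q) := fun q hq => by
    have := dirDeriv_congr hU id1 w q hq
    rwa [dirDeriv_add (cew.mul cg) (ce.mul cgw), dirDeriv_add (cmw.mul cm) (cm.mul cmw),
      dirDeriv_mul cew cg, dirDeriv_mul ce cgw, dirDeriv_mul cmw cm, dirDeriv_mul cm cmw] at this
  let κ := dirDeriv w m p / g p ^ 2
  refine ⟨κ, fun S hS hseg hgne => ?_⟩
  have hline : Continuous fun s : ℝ => p + s • v := by fun_prop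
  have hp0 : p + (0 : ℝ) • v = p := by simp
  have hpU : p ∈ U := by simpa using hseg 0 (left_mem_Icc.2 hS)
  have hm0 : m p = 0 := by
    have := hMA p hpU
    rw [h0, zero_mul] at this
    exact mul_self_eq_zero.1 this.symm
  have hmz : ∀ s ∈ Icc 0 S, m (p + s • v) = 0 := by
    let k : ℝ → ℝ := fun s => (2 * g (p + s • v) * dirDeriv w m (p + s • v) -
      m (p + s • v) * dirDeriv w g (p + s • v)) / g (p + s • v) ^ 2
    have hk : ContinuousOn k (Icc 0 S) := by
      refine ContinuousOn.div ?_ ?_ fun s hs => pow_ne_zero 2 (hgne s hs)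
      · have := cg.continuous; have := cm.continuous
        have := cmw.continuous; have := cgw.continuous
        fun_prop
      · have := cg.continuous; fun_prop
    obtain ⟨K, hK⟩ := isCompact_Icc.exists_bound_of_continuousOn hk
    have := norm_le_gronwallBound_of_norm_deriv_right_le (f := fun s : ℝ => m (p + s • v))
      (f' := fun s => dirDeriv v m (p + s • v)) (δ := 0) (K := K) (ε := 0) (a := 0) (b := S)
      (cm.continuous.comp hline).continuousOn
      (fun s _ => (hasDerivAt_line cm p v s).hasDerivWithinAt) (by simp [hm0])
      (fun s hs => by
        have hs' := Ico_subset_Icc_self hs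
        have hne := hgne s hs'
        have hd : dirDeriv v m (p + s • v) = k s * m (p + s • v) := by
          have h1 := id1 _ (hseg s hs')
          have h2 := hMA _ (hseg s hs')
          rw [hew] at h1
          simp only [k]
          field_simp
          linear_combination g (p + s • v) * h1 - dirDeriv w g (p + s • v) * h2
        rw [hd, norm_mul, add_zero]
        exact mul_le_mul_of_nonneg_right (hK s hs') (norm_nonneg _))
    intro s hs
    have := this s hs
    rw [gronwallBound_ε0_δ0] at this
    exact norm_le_zero_iff.1 this
  have hez : ∀ s ∈ Icc 0 S, e (p + s • v) = 0 := fun s hs => by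
    have := hMA _ (hseg s hs)
    rw [hmz s hs, mul_zero] at this
    exact (mul_eq_zero.1 this).resolve_right (hgne s hs)
  have hκ : ∀ s ∈ Icc 0 S, dirDeriv w m (p + s • v) / g (p + s • v) ^ 2 = κ := by
    have := constant_of_has_deriv_right_zero
      (f := fun s : ℝ => dirDeriv w m (p + s • v) / g (p + s • v) ^ 2) (a := 0) (b := S) ?_ ?_
    · intro s hs; simpa [κ] using this s hs
    · refine ContinuousOn.div (cmw.continuous.comp hline).continuousOn
        ((cg.continuous.comp hline).continuousOn.pow 2) fun s hs => pow_ne_zero 2 (hgne s hs)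
    · intro s hs
      have hs' := Ico_subset_Icc_self hs
      have hne := hgne s hs'
      have hd := (hasDerivAt_line cmw p v s).div ((hasDerivAt_line cg p v s).pow 2)
        (pow_ne_zero 2 hne)
      refine (hd.congr_deriv ?_).hasDerivWithinAt
      have h1 := id1 _ (hseg s hs')
      have h2 := id2 _ (hseg s hs')
      have h3 : dirDeriv v (dirDeriv w m) = dirDeriv w (dirDeriv w e) := by
        rw [dirDeriv_comm cm, hew]
      rw [hez s hs', hmz s hs'] at h1 h2
      have h4 : dirDeriv w e (p + s • v) = 0 := by simpa [hne] using h1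
      rw [h4] at h2
      rw [h3, ← hmw, div_eq_zero_iff]
      left
      simp only [Pi.pow_apply, Nat.cast_ofNat]
      linear_combination g (p + s • v) * h2
  have hinv : ∀ s ∈ Icc 0 S, (g (p + s • v))⁻¹ + κ * s = (g p)⁻¹ := by
    have := constant_of_has_deriv_right_zero
      (f := fun s : ℝ => (g (p + s • v))⁻¹ + κ * s) (a := 0) (b := S) ?_ ?_
    · intro s hs; simpa using this s hs
    · refine ContinuousOn.add ?_ (by fun_prop)
      exact (cg.continuous.comp hline).continuousOn.inv₀ hgne
    · intro s hs
      have hs' := Ico_subset_Icc_self hs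
      have hne := hgne s hs'
      have hd := ((hasDerivAt_line cg p v s).inv hne).add ((hasDerivAt_id s).const_mul κ)
      refine (hd.congr_deriv ?_).hasDerivWithinAt
      rw [← hκ s hs', ← hmw]
      field_simp
      ring
  have hSm := right_mem_Icc.2 hS
  refine ⟨hez S hSm, ?_⟩
  rw [← hinv S hSm]
  have := hgne S hSm
  field_simp
  ring

/-- For a solution of the homogeneous Monge-Ampère equation, the kernel of a non-zero Hessian is
constant along the line it spans. -/
theorem monge_ampere_line {φ : ℝ × ℝ → ℝ} (hφ : ContDiff ℝ ∞ φ) {U : Set (ℝ × ℝ)}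
    (hU : IsOpen U) {v w : ℝ × ℝ}
    (hMA : ∀ p ∈ U, dirDeriv v (dirDeriv v φ) p * dirDeriv w (dirDeriv w φ) p =
      dirDeriv w (dirDeriv v φ) p * dirDeriv w (dirDeriv v φ) p) {p : ℝ × ℝ}
    (h0 : dirDeriv v (dirDeriv v φ) p = 0) (hg0 : dirDeriv w (dirDeriv w φ) p ≠ 0)
    {S : ℝ} (hS : 0 ≤ S) (hseg : ∀ s ∈ Icc 0 S, p + s • v ∈ U) :
    dirDeriv v (dirDeriv v φ) (p + S • v) = 0 ∧ dirDeriv w (dirDeriv w φ) (p + S • v) ≠ 0 := by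
  obtain ⟨κ, hκ⟩ := monge_ampere_line_aux hφ hU hMA h0
  have cg : Continuous (dirDeriv w (dirDeriv w φ)) :=
    (dirDeriv_contDiff (dirDeriv_contDiff hφ _) _).continuous
  set g := dirDeriv w (dirDeriv w φ)
  have hc : Continuous fun s : ℝ => g (p + s • v) := by fun_prop
  have hne : ∀ s ∈ Icc 0 S, g (p + s • v) ≠ 0 := by
    by_contra! hcon
    obtain ⟨s, hs, hgs⟩ := hcon
    let Z : Set ℝ := Icc 0 S ∩ (fun s : ℝ => g (p + s • v)) ⁻¹' {0}
    have hZ : IsCompact Z := isCompact_Icc.inter_right (isClosed_singleton.preimage hc)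
    obtain ⟨t, ⟨⟨ht0, htS⟩, htg⟩, htmin⟩ := hZ.exists_isLeast ⟨s, hs, hgs⟩
    have ht0' : 0 < t := by
      rcases ht0.lt_or_eq with h | h
      · exact h
      · subst h; simp [hg0] at htg
    have hlt : ∀ r ∈ Ico 0 t, g (p + r • v) * ((g p)⁻¹ - κ * r) = 1 := fun r hr => by
      refine (hκ r hr.1 (fun s hs => hseg s ⟨hs.1, hs.2.trans (hr.2.le.trans htS)⟩) ?_).2
      intro s hs h
      have := htmin ⟨⟨hs.1, hs.2.trans (hr.2.le.trans htS)⟩, h⟩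
      exact absurd (hs.2.trans_lt hr.2) this.not_gt
    have hcl : IsClosed {r : ℝ | g (p + r • v) * ((g p)⁻¹ - κ * r) = 1} :=
      isClosed_eq (by fun_prop) continuous_const
    have htm : t ∈ {r : ℝ | g (p + r • v) * ((g p)⁻¹ - κ * r) = 1} := by
      refine hcl.closure_subset_iff.2 (fun r hr => hlt r hr) ?_
      rw [closure_Ico ht0'.ne]
      exact right_mem_Icc.2 ht0
    have htg' : g (p + t • v) = 0 := htg
    simp [htg'] at htm
  exact ⟨(hκ S hS hseg hne).1, hne S (right_mem_Icc.2 hS)⟩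

section Isometric

variable {f : ℝ × ℝ → EuclideanSpace ℝ (Fin 3)} {U : Set (ℝ × ℝ)}

theorem inner_dirDeriv_of_isometric {p : ℝ × ℝ}
    (hp : ∀ v : ℝ × ℝ, ‖fderiv ℝ f p v‖ = √(v.1 ^ 2 + v.2 ^ 2)) (v w : ℝ × ℝ) :
    ⟪dirDeriv v f p, dirDeriv w f p⟫_ℝ = v.1 * w.1 + v.2 * w.2 := by
  have hsq : ∀ v : ℝ × ℝ, ‖fderiv ℝ f p v‖ * ‖fderiv ℝ f p v‖ = v.1 ^ 2 + v.2 ^ 2 := fun v => by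
    rw [hp, Real.mul_self_sqrt (by positivity)]
  unfold dirDeriv
  rw [real_inner_eq_norm_add_mul_self_sub_norm_mul_self_sub_norm_mul_self_div_two, ← map_add,
    hsq, hsq, hsq]
  simp only [Prod.fst_add, Prod.snd_add]
  ring

/-- The second derivatives of an isometric immersion of a plane domain are normal. -/
theorem inner_dirDeriv_dirDeriv (hf : ContDiff ℝ ∞ f) (hU : IsOpen U)
    (hiso : ∀ p ∈ U, ∀ v : ℝ × ℝ, ‖fderiv ℝ f p v‖ = √(v.1 ^ 2 + v.2 ^ 2))
    (a b c : ℝ × ℝ) : ∀ p ∈ U, ⟪dirDeriv a (dirDeriv b f) p, dirDeriv c f p⟫_ℝ = 0 := by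
  intro p hp
  have hanti : ∀ a b c : ℝ × ℝ, ⟪dirDeriv a (dirDeriv b f) p, dirDeriv c f p⟫_ℝ =
      -⟪dirDeriv a (dirDeriv c f) p, dirDeriv b f p⟫_ℝ := fun a b c => by
    have := dirDeriv_congr hU (fun q hq => inner_dirDeriv_of_isometric (hiso q hq) b c) a p hp
    rw [dirDeriv_inner (dirDeriv_contDiff hf _) (dirDeriv_contDiff hf _), dirDeriv_const] at this
    rw [real_inner_comm (dirDeriv b f p)]
    linarith
  have h1 := hanti a b c
  have h2 := hanti c a b
  have h3 := hanti b c a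
  rw [dirDeriv_comm hf c a] at h2
  rw [dirDeriv_comm hf b c, dirDeriv_comm hf b a] at h3
  linarith

/-- The Gauss equation for flat surfaces. -/
theorem gauss_equation (hf : ContDiff ℝ ∞ f) (hU : IsOpen U)
    (hiso : ∀ p ∈ U, ∀ v : ℝ × ℝ, ‖fderiv ℝ f p v‖ = √(v.1 ^ 2 + v.2 ^ 2))
    (v w : ℝ × ℝ) : ∀ p ∈ U, ⟪dirDeriv v (dirDeriv v f) p, dirDeriv w (dirDeriv w f) p⟫_ℝ =
      ⟪dirDeriv w (dirDeriv v f) p, dirDeriv w (dirDeriv v f) p⟫_ℝ := by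
  intro p hp
  have cv := dirDeriv_contDiff hf v
  have cw := dirDeriv_contDiff hf w
  have h1 := dirDeriv_congr hU (inner_dirDeriv_dirDeriv hf hU hiso v v w) w p hp
  have h2 := dirDeriv_congr hU (inner_dirDeriv_dirDeriv hf hU hiso w v w) v p hp
  rw [dirDeriv_inner (dirDeriv_contDiff cv _) cw, dirDeriv_const] at h1 h2
  rw [dirDeriv_comm cv w v] at h1
  rw [dirDeriv_comm hf v w] at h2
  linarith

/-- Three vectors of `ℝ³` orthogonal to a common orthonormal pair are multiples of one vector. -/
theorem exists_smul_eq_of_orthogonal {X Y : EuclideanSpace ℝ (Fin 3)}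
    (hX : ⟪X, X⟫_ℝ = 1) (hY : ⟪Y, Y⟫_ℝ = 1) (hXY : ⟪X, Y⟫_ℝ = 0) :
    ∃ n : EuclideanSpace ℝ (Fin 3), ∀ A : EuclideanSpace ℝ (Fin 3), ⟪A, X⟫_ℝ = 0 → ⟪A, Y⟫_ℝ = 0 →
      ∃ c : ℝ, A = c • n := by
  have hli : LinearIndependent ℝ ![X, Y] := by
    refine LinearIndependent.pair_iff.2 fun s t h => ?_
    have h1 : ⟪s • X + t • Y, X⟫_ℝ = 0 := by rw [h, inner_zero_left]
    have h2 : ⟪s • X + t • Y, Y⟫_ℝ = 0 := by rw [h, inner_zero_left]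
    rw [inner_add_left, inner_smul_left, inner_smul_left] at h1 h2
    rw [real_inner_comm] at hXY
    rw [hX, hXY] at h1
    rw [real_inner_comm] at hXY
    rw [hXY, hY] at h2
    simp at h1 h2
    exact ⟨h1, h2⟩
  have h2 : Module.finrank ℝ (Submodule.span ℝ (range ![X, Y])) = 2 := by
    rw [finrank_span_eq_card hli]; simp
  have h3 := (Submodule.span ℝ (range ![X, Y])).finrank_add_finrank_orthogonal
  rw [h2, finrank_euclideanSpace_fin] at h3
  have h4 : Module.finrank ℝ (Submodule.span ℝ (range ![X, Y]))ᗮ = 1 := by omega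
  obtain ⟨n, -, hn⟩ := finrank_eq_one_iff'.1 h4
  refine ⟨n, fun A hAX hAY => ?_⟩
  have hA : A ∈ (Submodule.span ℝ (range ![X, Y]))ᗮ := by
    rw [Submodule.mem_orthogonal']
    intro u hu
    simp only [Matrix.range_cons, Matrix.range_empty, union_empty, singleton_union] at hu
    obtain ⟨s, t, rfl⟩ := Submodule.mem_span_pair.1 hu
    rw [inner_add_right, inner_smul_right, inner_smul_right, hAX, hAY]
    simp
  obtain ⟨c, hc⟩ := hn ⟨A, hA⟩
  exact ⟨c, by simpa using (congrArg Subtype.val hc).symm⟩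

theorem exists_second_fundamental_form (hf : ContDiff ℝ ∞ f) (hU : IsOpen U)
    (hiso : ∀ p ∈ U, ∀ v : ℝ × ℝ, ‖fderiv ℝ f p v‖ = √(v.1 ^ 2 + v.2 ^ 2))
    {v w : ℝ × ℝ} (hv : v.1 ^ 2 + v.2 ^ 2 = 1) (hw : w.1 ^ 2 + w.2 ^ 2 = 1)
    (hvw : v.1 * w.1 + v.2 * w.2 = 0) {p : ℝ × ℝ} (hp : p ∈ U) :
    ∃ (n : EuclideanSpace ℝ (Fin 3)) (e m g : ℝ), dirDeriv v (dirDeriv v f) p = e • n ∧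
      dirDeriv w (dirDeriv v f) p = m • n ∧ dirDeriv w (dirDeriv w f) p = g • n ∧
      (n = 0 ∨ e * g = m * m) := by
  have hin := inner_dirDeriv_of_isometric (hiso p hp)
  obtain ⟨n, hn⟩ := exists_smul_eq_of_orthogonal (X := dirDeriv v f p) (Y := dirDeriv w f p)
    (by rw [hin]; linarith) (by rw [hin]; linarith) (by rw [hin]; linarith)
  have hT := fun a b c => inner_dirDeriv_dirDeriv hf hU hiso a b c p hp
  obtain ⟨e, he⟩ := hn _ (hT v v v) (hT v v w)
  obtain ⟨m, hm⟩ := hn _ (hT w v v) (hT w v w)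
  obtain ⟨g, hg⟩ := hn _ (hT w w v) (hT w w w)
  refine ⟨n, e, m, g, he, hm, hg, ?_⟩
  have := gauss_equation hf hU hiso v w p hp
  rw [he, hm, hg] at this
  simp only [inner_smul_left, inner_smul_right, RCLike.conj_to_real] at this
  by_cases h0 : n = 0
  · exact Or.inl h0
  · right
    have hne : ⟪n, n⟫_ℝ ≠ 0 := fun h => h0 (inner_self_eq_zero.1 h)
    apply mul_right_cancel₀ hne
    linarith

theorem monge_ampere_of_isometric (hf : ContDiff ℝ ∞ f) (hU : IsOpen U)
    (hiso : ∀ p ∈ U, ∀ v : ℝ × ℝ, ‖fderiv ℝ f p v‖ = √(v.1 ^ 2 + v.2 ^ 2))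
    {v w : ℝ × ℝ} (hv : v.1 ^ 2 + v.2 ^ 2 = 1) (hw : w.1 ^ 2 + w.2 ^ 2 = 1)
    (hvw : v.1 * w.1 + v.2 * w.2 = 0) (N : EuclideanSpace ℝ (Fin 3)) {p : ℝ × ℝ} (hp : p ∈ U) :
    ⟪dirDeriv v (dirDeriv v f) p, N⟫_ℝ * ⟪dirDeriv w (dirDeriv w f) p, N⟫_ℝ =
      ⟪dirDeriv w (dirDeriv v f) p, N⟫_ℝ * ⟪dirDeriv w (dirDeriv v f) p, N⟫_ℝ := by
  obtain ⟨n, e, m, g, he, hm, hg, h⟩ := exists_second_fundamental_form hf hU hiso hv hw hvw hp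
  rw [he, hm, hg]
  simp only [inner_smul_left, RCLike.conj_to_real]
  rcases h with rfl | h
  · simp
  · linear_combination ⟪n, N⟫_ℝ ^ 2 * h

theorem dirDeriv_dirDeriv_eq_zero_on_line (hf : ContDiff ℝ ∞ f) (hU : IsOpen U)
    (hiso : ∀ p ∈ U, ∀ v : ℝ × ℝ, ‖fderiv ℝ f p v‖ = √(v.1 ^ 2 + v.2 ^ 2))
    {v w : ℝ × ℝ} (hv : v.1 ^ 2 + v.2 ^ 2 = 1) (hw : w.1 ^ 2 + w.2 ^ 2 = 1)
    (hvw : v.1 * w.1 + v.2 * w.2 = 0) (N : EuclideanSpace ℝ (Fin 3)) {p : ℝ × ℝ}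
    (h0 : ⟪dirDeriv v (dirDeriv v f) p, N⟫_ℝ = 0) (hg : ⟪dirDeriv w (dirDeriv w f) p, N⟫_ℝ ≠ 0)
    {S : ℝ} (hS : 0 ≤ S) (hseg : ∀ s ∈ Icc 0 S, p + s • v ∈ U) :
    dirDeriv v (dirDeriv v f) (p + S • v) = 0 := by
  have hd : ∀ a b : ℝ × ℝ, dirDeriv a (dirDeriv b fun q => ⟪f q, N⟫_ℝ) =
      fun q => ⟪dirDeriv a (dirDeriv b f) q, N⟫_ℝ := fun a b => by
    rw [dirDeriv_inner_const hf, dirDeriv_inner_const (dirDeriv_contDiff hf _)]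
  have := monge_ampere_line (φ := fun q => ⟪f q, N⟫_ℝ) (hf.inner ℝ contDiff_const) hU (v := v)
    (w := w) (p := p) (S := S)
    (fun q hq => by simpa only [hd] using monge_ampere_of_isometric hf hU hiso hv hw hvw N hq)
    (by simpa only [hd] using h0) (by simpa only [hd] using hg) hS hseg
  simp only [hd] at this
  obtain ⟨n, e, m, g, he, hm, hg, -⟩ := exists_second_fundamental_form hf hU hiso hv hw hvw
    (hseg S (right_mem_Icc.2 hS))
  rw [he, hg] at this
  simp only [inner_smul_left, RCLike.conj_to_real] at this
  have hnN : ⟪n, N⟫_ℝ ≠ 0 := fun h => this.2 (by rw [h, mul_zero])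
  rw [he, (mul_eq_zero.1 this.1).resolve_right hnN, zero_smul]

/-- Through a point where the second derivative does not vanish there is a direction in which
the surface is straight as far as the domain extends. -/
theorem exists_ruling_direction (hf : ContDiff ℝ ∞ f) (hU : IsOpen U)
    (hiso : ∀ p ∈ U, ∀ v : ℝ × ℝ, ‖fderiv ℝ f p v‖ = √(v.1 ^ 2 + v.2 ^ 2))
    {p d : ℝ × ℝ} (hp : p ∈ U) (hd : dirDeriv d (dirDeriv d f) p ≠ 0) :
    ∃ v : ℝ × ℝ, v.1 ^ 2 + v.2 ^ 2 = 1 ∧ ∀ u, u = v ∨ u = -v → ∀ S : ℝ, 0 ≤ S →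
      (∀ s ∈ Icc 0 S, p + s • u ∈ U) → dirDeriv u (dirDeriv u f) (p + S • u) = 0 := by
  set N := dirDeriv d (dirDeriv d f) p with hN
  have hexp : ∀ v : ℝ × ℝ, ⟪dirDeriv v (dirDeriv v f) p, N⟫_ℝ =
      v.1 ^ 2 * ⟪dirDeriv (1, 0) (dirDeriv (1, 0) f) p, N⟫_ℝ +
      2 * v.1 * v.2 * ⟪dirDeriv (0, 1) (dirDeriv (1, 0) f) p, N⟫_ℝ +
      v.2 ^ 2 * ⟪dirDeriv (0, 1) (dirDeriv (0, 1) f) p, N⟫_ℝ := fun v => by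
    have hv : v = v.1 • ((1 : ℝ), (0 : ℝ)) + v.2 • ((0 : ℝ), (1 : ℝ)) := by ext <;> simp
    have hc := congrFun (dirDeriv_comm hf (1, 0) (0, 1)) p
    rw [dirDeriv_dirDeriv hf, dirDeriv_dirDeriv hf] at hc
    rw [dirDeriv_dirDeriv hf, dirDeriv_dirDeriv hf, dirDeriv_dirDeriv hf, dirDeriv_dirDeriv hf]
    conv_lhs => rw [hv]
    simp only [map_add, map_smul, add_apply, smul_apply,
      inner_add_left, inner_smul_left, RCLike.conj_to_real, hc]
    ring
  have hMA := monge_ampere_of_isometric hf hU hiso (v := (1, 0)) (w := (0, 1)) (by simp) (by simp)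
    (by simp) N hp
  have hdd : ⟪dirDeriv d (dirDeriv d f) p, N⟫_ℝ ≠ 0 := fun h => hd (inner_self_eq_zero.1 h)
  rw [hexp] at hdd
  set E := ⟪dirDeriv (1, 0) (dirDeriv (1, 0) f) p, N⟫_ℝ
  set M := ⟪dirDeriv (0, 1) (dirDeriv (1, 0) f) p, N⟫_ℝ
  set G := ⟪dirDeriv (0, 1) (dirDeriv (0, 1) f) p, N⟫_ℝ
  obtain ⟨v, w, hv, hw, hvw, hHv, hHw⟩ : ∃ v w : ℝ × ℝ, v.1 ^ 2 + v.2 ^ 2 = 1 ∧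
      w.1 ^ 2 + w.2 ^ 2 = 1 ∧ v.1 * w.1 + v.2 * w.2 = 0 ∧
      v.1 ^ 2 * E + 2 * v.1 * v.2 * M + v.2 ^ 2 * G = 0 ∧
      w.1 ^ 2 * E + 2 * w.1 * w.2 * M + w.2 ^ 2 * G ≠ 0 := by
    by_cases hE : E = 0
    · have hM : M = 0 := by
        rw [hE, zero_mul] at hMA; exact mul_self_eq_zero.1 hMA.symm
      refine ⟨(1, 0), (0, 1), by simp, by simp, by simp, by simp [hE], ?_⟩
      rw [hE, hM] at hdd
      intro h
      simp at h hdd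
      exact hdd.2 h
    · have hpos : 0 < E ^ 2 + M ^ 2 := by positivity
      set r := √(E ^ 2 + M ^ 2)
      have hr : r ^ 2 = E ^ 2 + M ^ 2 := Real.sq_sqrt hpos.le
      have hr0 : r ≠ 0 := fun h => by rw [h] at hr; simp at hr; linarith
      refine ⟨(-M / r, E / r), (E / r, M / r), ?_, ?_, ?_, ?_, ?_⟩
      · simp only; field_simp; linarith
      · simp only; field_simp; linarith
      · simp only; field_simp; ring
      · simp only; field_simp; linear_combination E * hMA
      · simp only
        intro h
        have h' : (E ^ 2 * E + 2 * E * M * M + M ^ 2 * G) = 0 := by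
          field_simp at h; linarith
        have : (E ^ 2 + M ^ 2) ^ 2 = 0 := by linear_combination E * h' - M ^ 2 * hMA
        exact hpos.ne' (pow_eq_zero_iff two_ne_zero |>.1 this)
  refine ⟨v, hv, ?_⟩
  rintro u (rfl | rfl) S hS hseg
  · exact dirDeriv_dirDeriv_eq_zero_on_line hf hU hiso hv hw hvw N (by rw [hexp, hHv])
      (by rwa [hexp]) hS hseg
  · exact dirDeriv_dirDeriv_eq_zero_on_line hf hU hiso (v := -v) (w := w) (by simpa using hv) hw
      (by simp only [Prod.fst_neg, Prod.snd_neg]; linarith) N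
      (by rw [dirDeriv_neg_neg, hexp, hHv]) (by rwa [hexp]) hS hseg

end Isometric

theorem apply_add_smul_of_dirDeriv_eq_zero {V : Type*} [NormedAddCommGroup V] [NormedSpace ℝ V]
    {f : ℝ × ℝ → V} (hf : ContDiff ℝ ∞ f) {p v : ℝ × ℝ} {T : ℝ} (hT : 0 ≤ T)
    (h : ∀ s ∈ Ico 0 T, dirDeriv v (dirDeriv v f) (p + s • v) = 0) :
    f (p + T • v) = f p + T • dirDeriv v f p := by
  have cv := dirDeriv_contDiff hf v
  have hline : Continuous fun s : ℝ => p + s • v := by fun_prop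
  have h1 := constant_of_has_deriv_right_zero (f := fun s : ℝ => dirDeriv v f (p + s • v)) (a := 0)
    (b := T) (cv.continuous.comp hline).continuousOn fun s hs => by
      simpa only [h s hs] using (hasDerivAt_line cv p v s).hasDerivWithinAt
  have h2 := constant_of_has_deriv_right_zero
    (f := fun s : ℝ => f (p + s • v) - s • dirDeriv v f p) (a := 0) (b := T)
    (((hf.continuous.comp hline).sub (by fun_prop)).continuousOn) fun s hs => by
      have h3 := (hasDerivAt_line hf p v s).sub ((hasDerivAt_id s).smul_const (dirDeriv v f p))
      refine (h3.congr_deriv ?_).hasDerivWithinAt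
      rw [h1 s (Ico_subset_Icc_self hs)]
      simp
  have := h2 T (right_mem_Icc.2 hT)
  simp only [zero_smul, add_zero, sub_zero] at this
  rw [← this]; abel

/-- A smooth embedded paper Moebius band of aspect ratio `l`, as a map on the plane. -/
structure IsPaperMoebius (l : ℝ) (f : ℝ × ℝ → EuclideanSpace ℝ (Fin 3)) : Prop where
  pos : 0 < l
  smooth : ContDiff ℝ ∞ f
  glue : ∀ x, ∀ y ∈ Icc (0 : ℝ) 1, f (x + l, 1 - y) = f (x, y)
  isom : ∀ p : ℝ × ℝ, p.2 ∈ Icc (0 : ℝ) 1 → ∀ v : ℝ × ℝ,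
    ‖fderiv ℝ f p v‖ = √(v.1 ^ 2 + v.2 ^ 2)
  inj : ∀ x₁ x₂ y₁ y₂ : ℝ, x₁ ∈ Ico (0 : ℝ) l → x₂ ∈ Ico (0 : ℝ) l →
    y₁ ∈ Icc (0 : ℝ) 1 → y₂ ∈ Icc (0 : ℝ) 1 → f (x₁, y₁) = f (x₂, y₂) → x₁ = x₂ ∧ y₁ = y₂

/-- The pairs `(a, b)` for which `f` maps the segment from `(a, 0)` to `(b, 1)` to a segment. -/
def chords (f : ℝ × ℝ → EuclideanSpace ℝ (Fin 3)) : Set (ℝ × ℝ) :=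
  {c | ‖f (c.2, 1) - f (c.1, 0)‖ = √((c.2 - c.1) ^ 2 + 1)}

namespace IsPaperMoebius

variable {l : ℝ} {f : ℝ × ℝ → EuclideanSpace ℝ (Fin 3)} (hf : IsPaperMoebius l f)

include hf

theorem glue_two (x : ℝ) {y : ℝ} (hy : y ∈ Icc (0 : ℝ) 1) : f (x + 2 * l, y) = f (x, y) := by
  rw [← hf.glue x y hy, ← hf.glue (x + l) (1 - y) ⟨by linarith [hy.2], by linarith [hy.1]⟩]
  ring_nf

/-- Every segment across the band either is a straight chord or meets a straight chord. -/
theorem mem_chords_or_exists_crossing (a b : ℝ) : (a, b) ∈ chords f ∨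
    ∃ y ∈ Ioo (0 : ℝ) 1, ∃ c ∈ chords f, c.1 + y * (c.2 - c.1) = a + y * (b - a) := by
  have hU : IsOpen {p : ℝ × ℝ | 0 < p.2 ∧ p.2 < 1} :=
    (isOpen_lt continuous_const continuous_snd).inter (isOpen_lt continuous_snd continuous_const)
  have hiso : ∀ p ∈ {p : ℝ × ℝ | 0 < p.2 ∧ p.2 < 1}, ∀ v : ℝ × ℝ,
      ‖fderiv ℝ f p v‖ = √(v.1 ^ 2 + v.2 ^ 2) := fun p hp => hf.isom p ⟨hp.1.le, hp.2.le⟩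
  set d : ℝ × ℝ := (b - a, 1) with hd
  by_cases h : ∀ y ∈ Ioo (0 : ℝ) 1, dirDeriv d (dirDeriv d f) ((a, 0) + y • d) = 0
  · left
    have hcont : Continuous fun y : ℝ => dirDeriv d (dirDeriv d f) ((a, 0) + y • d) :=
      (dirDeriv_contDiff (dirDeriv_contDiff hf.smooth d) d).continuous.comp (by fun_prop)
    have hcl : IsClosed {y : ℝ | dirDeriv d (dirDeriv d f) ((a, 0) + y • d) = 0} :=
      isClosed_eq hcont continuous_const
    have hIcc := hcl.closure_subset_iff.2 h
    rw [closure_Ioo zero_ne_one] at hIcc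
    have := apply_add_smul_of_dirDeriv_eq_zero hf.smooth zero_le_one
      fun s hs => hIcc (Ico_subset_Icc_self hs)
    have hp : ((a, 0) : ℝ × ℝ) + (1 : ℝ) • d = (b, 1) := by ext <;> simp [hd]
    rw [hp, one_smul] at this
    simp only [chords, mem_ofPred_eq]
    rw [this, add_sub_cancel_left, dirDeriv, hf.isom _ (by simp)]
    simp [hd]
  · right
    push Not at h
    obtain ⟨y, hy, hne⟩ := h
    refine ⟨y, hy, ?_⟩
    set p : ℝ × ℝ := (a, 0) + y • d with hp
    have hp1 : p.1 = a + y * (b - a) := by simp [hp, hd]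
    have hp2 : p.2 = y := by simp [hp, hd]
    have hpIcc : p.2 ∈ Icc (0 : ℝ) 1 := by rw [hp2]; exact Ioo_subset_Icc_self hy
    obtain ⟨v, hv, hrul⟩ := exists_ruling_direction hf.smooth hU hiso (p := p)
      (by simpa [hp2] using hy) hne
    have hstr : ∀ u, u = v ∨ u = -v → ∀ T : ℝ, 0 ≤ T →
        (∀ s ∈ Ico 0 T, 0 < y + s * u.2 ∧ y + s * u.2 < 1) →
        f (p + T • u) = f p + T • dirDeriv u f p := fun u hu T hT hs => by
      refine apply_add_smul_of_dirDeriv_eq_zero hf.smooth hT fun s hs' => ?_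
      refine hrul u hu s hs'.1 fun r hr => ?_
      simpa [hp2] using hs r ⟨hr.1, hr.2.trans_lt hs'.2⟩
    have hv2 : v.2 ≠ 0 := fun hv2 => by
      have hu : ((1, 0) : ℝ × ℝ) = v ∨ ((1, 0) : ℝ × ℝ) = -v := by
        rw [hv2] at hv
        have : v.1 = 1 ∨ v.1 = -1 := sq_eq_one_iff.1 (by simpa using hv)
        rcases this with h | h
        · left; ext <;> simp [h, hv2]
        · right; ext <;> simp [h, hv2]
      have h1 := hstr _ hu (2 * l) (by linarith [hf.pos]) (fun s _ => by simpa using hy)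
      have h2 : p + (2 * l) • ((1, 0) : ℝ × ℝ) = (p.1 + 2 * l, p.2) := by ext <;> simp
      rw [h2, hf.glue_two _ hpIcc, left_eq_add, smul_eq_zero] at h1
      rcases h1 with h1 | h1
      · linarith [hf.pos]
      · have := hf.isom p hpIcc (1, 0)
        rw [dirDeriv] at h1
        rw [h1] at this
        simp at this
    obtain ⟨u, hu2, hu, hnu, hun⟩ : ∃ u : ℝ × ℝ, 0 < u.2 ∧ (u = v ∨ u = -v) ∧
        (-u = v ∨ -u = -v) ∧ u.1 ^ 2 + u.2 ^ 2 = 1 := by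
      rcases hv2.lt_or_gt with h | h
      · exact ⟨-v, by simpa using h, by simp, by simp, by simpa using hv⟩
      · exact ⟨v, h, by simp, by simp, hv⟩
    have hup := hstr u hu ((1 - y) / u.2) (div_nonneg (by linarith [hy.2]) hu2.le) fun s hs => by
      have := (lt_div_iff₀ hu2).1 hs.2
      have := mul_nonneg hs.1 hu2.le
      constructor <;> linarith [hy.1]
    have hdown := hstr (-u) hnu (y / u.2) (div_nonneg hy.1.le hu2.le) fun s hs => by
      have := (lt_div_iff₀ hu2).1 hs.2
      have := mul_nonneg hs.1 hu2.le
      simp only [Prod.snd_neg, mul_neg]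
      constructor <;> linarith [hy.2]
    refine ⟨(p.1 - y / u.2 * u.1, p.1 + (1 - y) / u.2 * u.1), ?_, ?_⟩
    · have e1 : p + ((1 - y) / u.2) • u = (p.1 + (1 - y) / u.2 * u.1, 1) := by
        ext
        · simp
        · simp [hp2]; field_simp; ring
      have e2 : p + (y / u.2) • -u = (p.1 - y / u.2 * u.1, 0) := by
        ext
        · simp; ring
        · simp [hp2]; field_simp; ring
      rw [e1] at hup
      rw [e2, dirDeriv_neg, Pi.neg_apply, smul_neg] at hdown
      simp only [chords, mem_ofPred_eq]
      rw [hup, hdown, add_sub_add_left_eq_sub, sub_neg_eq_add, ← add_smul, norm_smul, dirDeriv,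
        hf.isom p hpIcc, hun, Real.sqrt_one, mul_one]
      have : (1 - y) / u.2 + y / u.2 = 1 / u.2 := by field_simp; ring
      rw [this, Real.norm_of_nonneg (by positivity)]
      symm
      rw [Real.sqrt_eq_iff_mul_self_eq (by positivity) (by positivity)]
      field_simp
      linear_combination hun
    · simp only [← hp1]
      field_simp
      ring

end IsPaperMoebius

/-- `f` preserves the Euclidean distance of `z` and `w`. -/
def Rigid (f : ℝ × ℝ → EuclideanSpace ℝ (Fin 3)) (z w : ℝ × ℝ) : Prop :=
  ‖f w - f z‖ = √((w - z).1 ^ 2 + (w - z).2 ^ 2)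

theorem mem_chords_iff_rigid {f : ℝ × ℝ → EuclideanSpace ℝ (Fin 3)} {c : ℝ × ℝ} :
    c ∈ chords f ↔ Rigid f (c.1, 0) (c.2, 1) := by
  simp [chords, Rigid]

theorem sub_ne_zero_of_mem_chords {f : ℝ × ℝ → EuclideanSpace ℝ (Fin 3)} {c : ℝ × ℝ}
    (hc : c ∈ chords f) :
    f (c.2, 1) - f (c.1, 0) ≠ 0 := fun h => by
  have hc : ‖_‖ = _ := hc
  rw [h, norm_zero] at hc
  have : 0 < √((c.2 - c.1) ^ 2 + 1) := Real.sqrt_pos.2 (by positivity)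
  linarith

theorem Rigid.symm {f : ℝ × ℝ → EuclideanSpace ℝ (Fin 3)} {z w : ℝ × ℝ} (h : Rigid f z w) :
    Rigid f w z := by
  unfold Rigid at *
  rw [norm_sub_rev, h]
  congr 1
  simp only [Prod.fst_sub, Prod.snd_sub]
  ring

theorem snd_add_smul_sub_mem {z w : ℝ × ℝ} (hz : z.2 ∈ Icc (0 : ℝ) 1) (hw : w.2 ∈ Icc (0 : ℝ) 1)
    {t : ℝ} (ht : t ∈ Icc (0 : ℝ) 1) : (z + t • (w - z)).2 ∈ Icc (0 : ℝ) 1 := by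
  have := (convex_Icc (0 : ℝ) 1).add_smul_sub_mem hz hw ht
  simpa using this

namespace IsPaperMoebius

variable {l : ℝ} {f : ℝ × ℝ → EuclideanSpace ℝ (Fin 3)} (hf : IsPaperMoebius l f)
  {z w : ℝ × ℝ}

include hf

theorem norm_sub_le (hz : z.2 ∈ Icc (0 : ℝ) 1) (hw : w.2 ∈ Icc (0 : ℝ) 1) :
    ‖f w - f z‖ ≤ √((w - z).1 ^ 2 + (w - z).2 ^ 2) := by
  have := norm_image_sub_le_of_norm_deriv_le_segment_01' (f := fun t : ℝ => f (z + t • (w - z)))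
    (fun t _ => (hasDerivAt_line hf.smooth z (w - z) t).hasDerivWithinAt)
    (fun t ht => (hf.isom _ (snd_add_smul_sub_mem hz hw (Ico_subset_Icc_self ht)) _).le)
  simpa using this

theorem apply_add_smul_of_rigid (hz : z.2 ∈ Icc (0 : ℝ) 1) (hw : w.2 ∈ Icc (0 : ℝ) 1)
    (h : Rigid f z w) {t : ℝ} (ht : t ∈ Icc (0 : ℝ) 1) :
    f (z + t • (w - z)) = f z + t • (f w - f z) := by
  have hq := snd_add_smul_sub_mem hz hw ht
  set q := z + t • (w - z) with hqdef
  have h1 := hf.norm_sub_le hz hq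
  have h2 := hf.norm_sub_le hq hw
  have hs : ∀ r : ℝ, 0 ≤ r → √((r • (w - z)).1 ^ 2 + (r • (w - z)).2 ^ 2) = r * ‖f w - f z‖ :=
    fun r hr => by
      rw [h, Prod.smul_fst, Prod.smul_snd, smul_eq_mul, smul_eq_mul, mul_pow, mul_pow, ← mul_add,
        Real.sqrt_mul (sq_nonneg r), Real.sqrt_sq hr]
  rw [show q - z = t • (w - z) by rw [hqdef]; abel, hs t ht.1] at h1
  rw [show w - q = (1 - t) • (w - z) by rw [hqdef, sub_smul, one_smul]; abel,
    hs _ (by linarith [ht.2])] at h2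
  have h3 : ‖f w - f z‖ ≤ ‖f w - f q‖ + ‖f q - f z‖ := norm_sub_le_norm_sub_add_norm_sub _ _ _
  have := eq_lineMap_of_dist_eq_mul_of_dist_eq_mul (x := f z) (y := f q) (z := f w) (r := t)
    (by rw [dist_comm, dist_comm (f z), dist_eq_norm, dist_eq_norm]; linarith)
    (by rw [dist_comm, dist_comm (f z), dist_eq_norm, dist_eq_norm]; linarith)
  rw [this, AffineMap.lineMap_apply, vsub_eq_sub, vadd_eq_add, add_comm]

theorem rigid_add_smul (hz : z.2 ∈ Icc (0 : ℝ) 1) (hw : w.2 ∈ Icc (0 : ℝ) 1)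
    (h : Rigid f z w) {t : ℝ} (ht : t ∈ Icc (0 : ℝ) 1) : Rigid f z (z + t • (w - z)) := by
  rw [Rigid, hf.apply_add_smul_of_rigid hz hw h ht, add_sub_cancel_left, add_sub_cancel_left,
    norm_smul, h, Prod.smul_fst, Prod.smul_snd, smul_eq_mul, smul_eq_mul, mul_pow, mul_pow,
    ← mul_add, Real.sqrt_mul (sq_nonneg t), Real.sqrt_sq ht.1, Real.norm_of_nonneg ht.1]

theorem fderiv_sub_of_rigid (hz : z.2 ∈ Icc (0 : ℝ) 1) (hw : w.2 ∈ Icc (0 : ℝ) 1)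
    (h : Rigid f z w) : fderiv ℝ f z (w - z) = f w - f z := by
  have h0 : (0 : ℝ) ∈ Icc (0 : ℝ) 1 := left_mem_Icc.2 zero_le_one
  have h1 := (hasDerivAt_line hf.smooth z (w - z) 0).hasDerivWithinAt (s := Icc 0 1)
  have h2 := (((hasDerivAt_id (0 : ℝ)).smul_const (f w - f z)).const_add (f z)).hasDerivWithinAt
    (s := Icc 0 1)
  have h3 := h2.congr (f₁ := fun t : ℝ => f (z + t • (w - z)))
    (fun t ht => hf.apply_add_smul_of_rigid hz hw h ht)
    (hf.apply_add_smul_of_rigid hz hw h h0)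
  have := (uniqueDiffOn_Icc zero_lt_one 0 h0).eq_deriv _ h1 h3
  simpa [dirDeriv] using this

/-- Two straight segments issuing from one point span a straight triangle. -/
theorem rigid_of_rigid_of_rigid {q : ℝ × ℝ} (hq : q.2 ∈ Icc (0 : ℝ) 1) (hz : z.2 ∈ Icc (0 : ℝ) 1)
    (hw : w.2 ∈ Icc (0 : ℝ) 1) (h₁ : Rigid f q z) (h₂ : Rigid f q w) : Rigid f z w := by
  have : f w - f z = fderiv ℝ f q (w - z) := by
    rw [← sub_sub_sub_cancel_right w z q, map_sub, hf.fderiv_sub_of_rigid hq hz h₁,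
      hf.fderiv_sub_of_rigid hq hw h₂]
    abel
  rw [Rigid, this, hf.isom q hq]

/-- The point at height `y` of a chord. -/
theorem apply_chord {c : ℝ × ℝ} (hc : c ∈ chords f) {y : ℝ} (hy : y ∈ Icc (0 : ℝ) 1) :
    f (c.1 + y * (c.2 - c.1), y) = f (c.1, 0) + y • (f (c.2, 1) - f (c.1, 0)) := by
  rw [← hf.apply_add_smul_of_rigid (by simp) (by simp) (mem_chords_iff_rigid.1 hc) hy]
  simp

theorem mem_chords_of_crossing {c d : ℝ × ℝ} (hc : c ∈ chords f) (hd : d ∈ chords f) {y : ℝ}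
    (hy : y ∈ Icc (0 : ℝ) 1) (h : c.1 + y * (c.2 - c.1) = d.1 + y * (d.2 - d.1)) :
    (c.1, d.2) ∈ chords f := by
  have hy' : 1 - y ∈ Icc (0 : ℝ) 1 := ⟨by linarith [hy.2], by linarith [hy.1]⟩
  have h1 := hf.rigid_add_smul (by simp) (by simp) (mem_chords_iff_rigid.1 hc) hy
  have h2 := hf.rigid_add_smul (by simp) (by simp) (mem_chords_iff_rigid.1 hd).symm hy'
  have e1 : ((c.1, 0) : ℝ × ℝ) + y • ((c.2, 1) - (c.1, 0)) = (c.1 + y * (c.2 - c.1), y) := by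
    ext <;> simp
  have e2 : ((d.2, 1) : ℝ × ℝ) + (1 - y) • ((d.1, 0) - (d.2, 1)) = (c.1 + y * (c.2 - c.1), y) := by
    ext
    · simp [h]; ring
    · simp
  rw [e1] at h1
  rw [e2] at h2
  exact mem_chords_iff_rigid.2 (hf.rigid_of_rigid_of_rigid (q := (c.1 + y * (c.2 - c.1), y)) hy
    (by simp) (by simp) h1.symm h2.symm)

theorem sup_inf_mem_chords {c d : ℝ × ℝ} (hc : c ∈ chords f) (hd : d ∈ chords f) :
    c ⊔ d ∈ chords f ∧ c ⊓ d ∈ chords f := by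
  have key : ∀ {c d : ℝ × ℝ}, c ∈ chords f → d ∈ chords f → c.1 ≤ d.1 → d.2 ≤ c.2 →
      (d.1, c.2) ∈ chords f ∧ (c.1, d.2) ∈ chords f := fun {c d} hc hd h1 h2 => by
    rcases (add_nonneg (sub_nonneg.2 h1) (sub_nonneg.2 h2)).eq_or_lt with h | h
    · have e1 : c.1 = d.1 := by linarith
      have e2 : c.2 = d.2 := by linarith
      rw [e2, ← e1]
      exact ⟨by rwa [e1], by rwa [← e2]⟩
    · have hy : (d.1 - c.1) / ((d.1 - c.1) + (c.2 - d.2)) ∈ Icc (0 : ℝ) 1 :=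
        ⟨div_nonneg (by linarith) h.le, (div_le_one h).2 (by linarith)⟩
      have hx : c.1 + (d.1 - c.1) / ((d.1 - c.1) + (c.2 - d.2)) * (c.2 - c.1) =
          d.1 + (d.1 - c.1) / ((d.1 - c.1) + (c.2 - d.2)) * (d.2 - d.1) := by
        field_simp; ring
      exact ⟨hf.mem_chords_of_crossing hd hc hy hx.symm, hf.mem_chords_of_crossing hc hd hy hx⟩
  rcases le_total c.1 d.1 with h1 | h1 <;> rcases le_total c.2 d.2 with h2 | h2
  · have : c ≤ d := ⟨h1, h2⟩
    rw [sup_eq_right.2 this, inf_eq_left.2 this]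
    exact ⟨hd, hc⟩
  · have := key hc hd h1 h2
    rwa [show c ⊔ d = (d.1, c.2) from Prod.ext (sup_eq_right.2 h1) (sup_eq_left.2 h2),
      show c ⊓ d = (c.1, d.2) from Prod.ext (inf_eq_left.2 h1) (inf_eq_right.2 h2)]
  · have := key hd hc h1 h2
    rwa [show c ⊔ d = (c.1, d.2) from Prod.ext (sup_eq_left.2 h1) (sup_eq_right.2 h2),
      show c ⊓ d = (d.1, c.2) from Prod.ext (inf_eq_right.2 h1) (inf_eq_left.2 h2)]
  · have : d ≤ c := ⟨h1, h2⟩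
    rw [sup_eq_left.2 this, inf_eq_right.2 this]
    exact ⟨hc, hd⟩

theorem isClosed_chords : IsClosed (chords f) := by
  have := hf.smooth.continuous
  exact isClosed_eq (by fun_prop) (by fun_prop)

theorem apply_add_zero (x : ℝ) : f (x + l, 0) = f (x, 1) := by
  simpa using hf.glue x 1 (by simp)

theorem apply_add_one (x : ℝ) : f (x + l, 1) = f (x, 0) := by
  simpa using hf.glue x 0 (by simp)

theorem shift_mem_chords {c : ℝ × ℝ} (hc : c ∈ chords f) : (c.2 + l, c.1 + l) ∈ chords f := by
  simp only [chords, mem_ofPred_eq] at *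
  rw [hf.apply_add_one, hf.apply_add_zero, norm_sub_rev, hc]
  congr 1
  ring

theorem abs_sub_le_of_mem_chords {c : ℝ × ℝ} (hc : c ∈ chords f) : |c.2 - c.1| ≤ l := by
  by_contra! h
  have hl := hf.pos
  set t := c.2 - c.1 with ht
  have ht0 : t ≠ 0 := fun h0 => by rw [h0, abs_zero] at h; linarith
  have ht2 : l ^ 2 < t ^ 2 := by rw [← sq_abs t]; gcongr
  have hsum : (t + l) / (2 * t) + (t - l) / (2 * t) = 1 := by field_simp; ring
  have hpos : 0 ≤ (t + l) / (2 * t) ∧ 0 ≤ (t - l) / (2 * t) := by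
    rcases lt_abs.1 h with h | h
    · exact ⟨div_nonneg (by linarith) (by linarith), div_nonneg (by linarith) (by linarith)⟩
    · exact ⟨div_nonneg_of_nonpos (by linarith) (by linarith),
        div_nonneg_of_nonpos (by linarith) (by linarith)⟩
  have hy : (t + l) / (2 * t) ∈ Icc (0 : ℝ) 1 := ⟨hpos.1, by linarith⟩
  have hy' : 1 - (t + l) / (2 * t) ∈ Icc (0 : ℝ) 1 := ⟨by linarith, by linarith⟩
  have h1 := hf.apply_chord hc hy
  have h2 := hf.apply_chord hc hy'
  have h3 := hf.glue (c.1 + (1 - (t + l) / (2 * t)) * t) (1 - (t + l) / (2 * t)) hy'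
  rw [sub_sub_cancel, show c.1 + (1 - (t + l) / (2 * t)) * t + l = c.1 + (t + l) / (2 * t) * t by
    field_simp; ring] at h3
  rw [← ht] at h1 h2
  rw [h1, h2, add_right_inj] at h3
  have h4 := smul_left_injective ℝ (sub_ne_zero_of_mem_chords hc) h3
  field_simp at h4
  linarith

theorem le_shift {c : ℝ × ℝ} (hc : c ∈ chords f) : c ≤ (c.2 + l, c.1 + l) := by
  have := abs_le.1 (hf.abs_sub_le_of_mem_chords hc)
  constructor <;> simp only <;> linarith

theorem chords_nonempty : (chords f).Nonempty := by
  rcases hf.mem_chords_or_exists_crossing 0 0 with h | ⟨y, -, c, hc, -⟩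
  exacts [⟨_, h⟩, ⟨c, hc⟩]

theorem exists_mem_chords_between {c d : ℝ × ℝ} (hc : c ∈ chords f) (hd : d ∈ chords f)
    (hcd : c < d) : ∃ e ∈ chords f, c < e ∧ e < d := by
  have h12 : (1 / 2 : ℝ) ∈ Icc (0 : ℝ) 1 := by constructor <;> norm_num
  rcases hcd.le.1.eq_or_lt with h1 | h1
  · have h2 : c.2 < d.2 := lt_of_le_of_ne hcd.le.2 fun h => hcd.ne (Prod.ext h1 h)
    have hr := hf.rigid_of_rigid_of_rigid (z := (c.2, 1)) (w := (d.2, 1)) (by simp) (by simp)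
      (by simp) (mem_chords_iff_rigid.1 hc) (by rw [h1]; exact mem_chords_iff_rigid.1 hd)
    have hm := hf.rigid_add_smul (by simp) (by simp) hr h12
    have he : ((c.2, 1) : ℝ × ℝ) + (1 / 2 : ℝ) • ((d.2, 1) - (c.2, 1)) = ((c.2 + d.2) / 2, 1) := by
      ext
      · simp; ring
      · simp
    rw [he] at hm
    refine ⟨(c.1, (c.2 + d.2) / 2), mem_chords_iff_rigid.2
      (hf.rigid_of_rigid_of_rigid (by simp) (by simp) (by simp)
        (mem_chords_iff_rigid.1 hc).symm hm), Prod.lt_iff.2 (Or.inr ⟨le_rfl, ?_⟩),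
        Prod.lt_iff.2 (Or.inr ⟨h1.le, ?_⟩)⟩ <;> simp only <;> linarith
  rcases hcd.le.2.eq_or_lt with h2 | h2
  · have hr := hf.rigid_of_rigid_of_rigid (z := (c.1, 0)) (w := (d.1, 0)) (by simp) (by simp)
      (by simp) (mem_chords_iff_rigid.1 hc).symm
      (by rw [h2]; exact (mem_chords_iff_rigid.1 hd).symm)
    have hm := hf.rigid_add_smul (by simp) (by simp) hr h12
    have he : ((c.1, 0) : ℝ × ℝ) + (1 / 2 : ℝ) • ((d.1, 0) - (c.1, 0)) = ((c.1 + d.1) / 2, 0) := by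
      ext
      · simp; ring
      · simp
    rw [he] at hm
    refine ⟨((c.1 + d.1) / 2, c.2), mem_chords_iff_rigid.2
      (hf.rigid_of_rigid_of_rigid (by simp) (by simp) (by simp)
        (mem_chords_iff_rigid.1 hc) hm).symm, Prod.lt_iff.2 (Or.inl ⟨?_, le_rfl⟩),
        Prod.lt_iff.2 (Or.inl ⟨?_, h2.le⟩)⟩ <;> simp only <;> linarith
  rcases hf.mem_chords_or_exists_crossing ((c.1 + d.1) / 2) ((c.2 + d.2) / 2) with
    h | ⟨y, hy, e, he, hcross⟩
  · refine ⟨_, h, Prod.lt_iff.2 (Or.inl ⟨?_, ?_⟩), Prod.lt_iff.2 (Or.inl ⟨?_, ?_⟩)⟩ <;>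
      simp only <;> linarith
  · have hy1 : 0 < 1 - y := sub_pos.2 hy.2
    refine ⟨(e ⊔ c) ⊓ d, (hf.sup_inf_mem_chords (hf.sup_inf_mem_chords he hc).1 hd).2,
      lt_of_le_of_ne (le_inf le_sup_right hcd.le) fun h => ?_,
      lt_of_le_of_ne inf_le_right fun h => ?_⟩
    · have hle : e ≤ c := by
        constructor
        · have h' : c.1 = min (max e.1 c.1) d.1 := congrArg Prod.fst h
          rcases min_choice (max e.1 c.1) d.1 with h3 | h3
          · rw [h3] at h'; rw [h']; exact le_max_left _ _
          · linarith
        · have h' : c.2 = min (max e.2 c.2) d.2 := congrArg Prod.snd h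
          rcases min_choice (max e.2 c.2) d.2 with h3 | h3
          · rw [h3] at h'; rw [h']; exact le_max_left _ _
          · linarith
      nlinarith [mul_le_mul_of_nonneg_left hle.1 hy1.le, mul_le_mul_of_nonneg_left hle.2 hy.1.le,
        mul_lt_mul_of_pos_left h1 hy1, mul_lt_mul_of_pos_left h2 hy.1]
    · have hle : d ≤ e := by
        constructor
        · have h' : min (max e.1 c.1) d.1 = d.1 := congrArg Prod.fst h
          exact (le_max_iff.1 (min_eq_right_iff.1 h')).resolve_right h1.not_ge
        · have h' : min (max e.2 c.2) d.2 = d.2 := congrArg Prod.snd h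
          exact (le_max_iff.1 (min_eq_right_iff.1 h')).resolve_right h2.not_ge
      nlinarith [mul_le_mul_of_nonneg_left hle.1 hy1.le, mul_le_mul_of_nonneg_left hle.2 hy.1.le,
        mul_lt_mul_of_pos_left h1 hy1, mul_lt_mul_of_pos_left h2 hy.1]

end IsPaperMoebius

/-- A closed set of the ordered plane without gaps contains a monotone curve joining any two of
its comparable points. -/
theorem exists_monotone_curve {K : Set (ℝ × ℝ)} (hK : IsClosed K)
    (hgap : ∀ c ∈ K, ∀ d ∈ K, c < d → ∃ e ∈ K, c < e ∧ e < d) {c₀ c₁ : ℝ × ℝ} (h₀ : c₀ ∈ K)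
    (h₁ : c₁ ∈ K) (h01 : c₀ ≤ c₁) :
    ∃ γ : ℝ → ℝ × ℝ, Continuous γ ∧ Monotone γ ∧ γ (c₀.1 + c₀.2) = c₀ ∧ γ (c₁.1 + c₁.2) = c₁ ∧
      (∀ s, γ s ∈ K) ∧ ∀ s ∈ Icc (c₀.1 + c₀.2) (c₁.1 + c₁.2), (γ s).1 + (γ s).2 = s := by
  obtain ⟨M, hM⟩ := zorn_subset {A : Set (ℝ × ℝ) | A ⊆ K ∩ Icc c₀ c₁ ∧ IsChain (· ≤ ·) A}
    fun 𝒜 h𝒜 hch => ⟨⋃₀ 𝒜, ⟨sUnion_subset fun A hA => (h𝒜 hA).1,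
      fun x ⟨A, hA, hx⟩ y ⟨B, hB, hy⟩ hxy => (hch.total hA hB).elim
        (fun h => (h𝒜 hB).2 (h hx) hy hxy) (fun h => (h𝒜 hA).2 hx (h hy) hxy)⟩,
      fun A hA => subset_sUnion_of_mem hA⟩
  have hMK : M ⊆ K ∩ Icc c₀ c₁ := hM.prop.1
  have hcomp : ∀ x ∈ M, ∀ y ∈ M, x ≤ y ∨ y ≤ x := fun x hx y hy => hM.prop.2.total hx hy
  have hmem : ∀ e ∈ K ∩ Icc c₀ c₁, (∀ m ∈ M, e ≤ m ∨ m ≤ e) → e ∈ M := fun e he hem => by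
    refine hM.le_of_ge (y := insert e M) ⟨insert_subset he hMK, ?_⟩ (subset_insert e M)
      (mem_insert e M)
    exact hM.prop.2.insert fun m hm _ => hem m hm
  have hM0 : c₀ ∈ M := hmem _ ⟨h₀, left_mem_Icc.2 h01⟩ fun m hm => Or.inl (hMK hm).2.1
  have hM1 : c₁ ∈ M := hmem _ ⟨h₁, right_mem_Icc.2 h01⟩ fun m hm => Or.inr (hMK hm).2.2
  have hMclosed : IsClosed M := by
    refine isClosed_of_closure_subset fun e he => hmem e ?_ fun m hm => ?_
    · exact closure_minimal hMK (hK.inter isClosed_Icc) he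
    · have hcl : IsClosed {x : ℝ × ℝ | x ≤ m ∨ m ≤ x} := by
        rw [ofPred_or]
        exact isClosed_Iic.union isClosed_Ici
      exact closure_minimal (fun x hx => hcomp x hx m hm) hcl he
  have hMcompact : IsCompact M :=
    isCompact_Icc.of_isClosed_subset hMclosed fun m hm => (hMK hm).2
  set σ : ℝ × ℝ → ℝ := fun c => c.1 + c.2 with hσ
  have hσc : Continuous σ := by fun_prop
  have hσle : ∀ c d : ℝ × ℝ, c ≤ d → σ c ≤ σ d := fun c d h => add_le_add h.1 h.2
  have hσlt : ∀ c d : ℝ × ℝ, c < d → σ c < σ d := fun c d h => by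
    rcases Prod.lt_iff.1 h with h | h
    · exact add_lt_add_of_lt_of_le h.1 h.2
    · exact add_lt_add_of_le_of_lt h.1 h.2
  have hle_of_σ : ∀ x ∈ M, ∀ y ∈ M, σ x ≤ σ y → x ≤ y := fun x hx y hy h => by
    rcases hcomp x hx y hy with h' | h'
    · exact h'
    · rcases h'.eq_or_lt with h' | h'
      · exact h'.ge
      · exact absurd (hσlt _ _ h') h.not_gt
  have hScompact : IsCompact (σ '' M) := hMcompact.image hσc
  have hsurj : ∀ s ∈ Icc (σ c₀) (σ c₁), ∃ c ∈ M, σ c = s := fun s hs => by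
    by_contra! hne
    obtain ⟨_, ⟨⟨c, hc, rfl⟩, hcs⟩, hcmax⟩ := (hScompact.inter_right isClosed_Iic).exists_isGreatest
      ⟨σ c₀, mem_image_of_mem σ hM0, hs.1⟩
    obtain ⟨_, ⟨⟨d, hd, rfl⟩, hds⟩, hdmin⟩ := (hScompact.inter_right isClosed_Ici).exists_isLeast
      ⟨σ c₁, mem_image_of_mem σ hM1, hs.2⟩
    have hcs' : σ c < s := lt_of_le_of_ne hcs (hne c hc)
    have hds' : s < σ d := lt_of_le_of_ne hds (hne d hd).symm
    have hcd : c < d := lt_of_le_of_ne (hle_of_σ c hc d hd (hcs'.trans hds').le) fun h => by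
      rw [h] at hcs'; exact lt_asymm hcs' hds'
    obtain ⟨e, heK, hce, hed⟩ := hgap c (hMK hc).1 d (hMK hd).1 hcd
    have heM : e ∈ M := hmem e ⟨heK, (hMK hc).2.1.trans hce.le, hed.le.trans (hMK hd).2.2⟩
      fun m hm => by
        rcases le_total (σ m) s with h | h
        · exact Or.inr ((hle_of_σ m hm c hc (hcmax ⟨mem_image_of_mem σ hm, h⟩)).trans hce.le)
        · exact Or.inl (hed.le.trans (hle_of_σ d hd m hm (hdmin ⟨mem_image_of_mem σ hm, h⟩)))
    rcases le_total (σ e) s with h | h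
    · exact (hσlt _ _ hce).not_ge (hcmax ⟨mem_image_of_mem σ heM, h⟩)
    · exact (hσlt _ _ hed).not_ge (hdmin ⟨mem_image_of_mem σ heM, h⟩)
  have hσ01 := hσle _ _ h01
  choose g hgM hgσ using fun s : Icc (σ c₀) (σ c₁) => hsurj s s.2
  have hginv : ∀ c, ∀ hc : c ∈ M, ∀ hs, g ⟨σ c, hs⟩ = c := fun c hc hs =>
    le_antisymm (hle_of_σ _ (hgM _) _ hc (hgσ _).le) (hle_of_σ _ hc _ (hgM _) (hgσ ⟨σ c, hs⟩).ge)
  have hgmono : Monotone g := fun s t hst =>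
    hle_of_σ _ (hgM _) _ (hgM _) (by rw [hgσ, hgσ]; exact hst)
  have hglip : LipschitzWith 1 g := LipschitzWith.of_dist_le_mul fun s t => by
    wlog hst : s ≤ t generalizing s t
    · rw [dist_comm, dist_comm s]
      exact this t s (le_of_not_ge hst)
    have h1 := hgmono hst
    have h2 : (g s).1 + (g s).2 = s := hgσ s
    have h3 : (g t).1 + (g t).2 = t := hgσ t
    have h4 : (s : ℝ) ≤ t := hst
    rw [NNReal.coe_one, one_mul, Prod.dist_eq, Subtype.dist_eq, Real.dist_eq, Real.dist_eq,
      Real.dist_eq, abs_of_nonpos (sub_nonpos.2 h1.1), abs_of_nonpos (sub_nonpos.2 h1.2),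
      abs_of_nonpos (sub_nonpos.2 h4)]
    exact max_le (by linarith [h1.2]) (by linarith [h1.1])
  refine ⟨fun s => g (projIcc _ _ hσ01 s), hglip.continuous.comp continuous_projIcc,
    hgmono.comp (monotone_projIcc _), ?_, ?_, fun s => (hMK (hgM _)).1, fun s hs => ?_⟩
  · change g (projIcc _ _ hσ01 (σ c₀)) = c₀
    rw [projIcc_left]
    exact hginv _ hM0 _
  · change g (projIcc _ _ hσ01 (σ c₁)) = c₁
    rw [projIcc_right]
    exact hginv _ hM1 _
  · change σ (g (projIcc _ _ hσ01 s)) = s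
    rw [hgσ, projIcc_of_mem hσ01 hs]

/-- The triple product of three vectors of `ℝ³`. -/
def triple (x y z : EuclideanSpace ℝ (Fin 3)) : ℝ :=
  x 0 * (y 1 * z 2 - y 2 * z 1) - x 1 * (y 0 * z 2 - y 2 * z 0) + x 2 * (y 0 * z 1 - y 1 * z 0)

theorem triple_sq (x y z : EuclideanSpace ℝ (Fin 3)) :
    triple x y z ^ 2 = ⟪x, x⟫_ℝ * ⟪y, y⟫_ℝ * ⟪z, z⟫_ℝ + 2 * ⟪x, y⟫_ℝ * ⟪y, z⟫_ℝ * ⟪x, z⟫_ℝ -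
      ⟪x, x⟫_ℝ * ⟪y, z⟫_ℝ ^ 2 - ⟪y, y⟫_ℝ * ⟪x, z⟫_ℝ ^ 2 - ⟪z, z⟫_ℝ * ⟪x, y⟫_ℝ ^ 2 := by
  simp only [triple, PiLp.inner_apply, Fin.sum_univ_three, RCLike.inner_apply, conj_trivial]
  ring

theorem exists_eq_smul_add_smul_of_triple_eq_zero {w u v : EuclideanSpace ℝ (Fin 3)} (hu : u ≠ 0)
    (hv : v ≠ 0) (huv : ⟪u, v⟫_ℝ = 0) (h : triple w u v = 0) :
    ∃ p q : ℝ, w = p • u + q • v := by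
  have hu' : ⟪u, u⟫_ℝ ≠ 0 := inner_self_ne_zero.2 hu
  have hv' : ⟪v, v⟫_ℝ ≠ 0 := inner_self_ne_zero.2 hv
  have hvu : ⟪v, u⟫_ℝ = 0 := by rw [real_inner_comm, huv]
  refine ⟨⟪w, u⟫_ℝ / ⟪u, u⟫_ℝ, ⟪w, v⟫_ℝ / ⟪v, v⟫_ℝ, ?_⟩
  set p := ⟪w, u⟫_ℝ / ⟪u, u⟫_ℝ with hp
  set q := ⟪w, v⟫_ℝ / ⟪v, v⟫_ℝ with hq
  have h1 : ⟪w - (p • u + q • v), u⟫_ℝ = 0 := by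
    simp only [inner_sub_left, inner_add_left, inner_smul_left, conj_trivial, hvu, hp]
    field_simp
    ring
  have h2 : ⟪w - (p • u + q • v), v⟫_ℝ = 0 := by
    simp only [inner_sub_left, inner_add_left, inner_smul_left, conj_trivial, huv, hq]
    field_simp
    ring
  have h3 : triple (w - (p • u + q • v)) u v = triple w u v := by
    simp only [triple, PiLp.sub_apply, PiLp.add_apply, PiLp.smul_apply, smul_eq_mul]
    ring
  have h4 := triple_sq (w - (p • u + q • v)) u v
  rw [h3, h, h1, h2, huv] at h4
  have h5 : ⟪w - (p • u + q • v), w - (p • u + q • v)⟫_ℝ * (⟪u, u⟫_ℝ * ⟪v, v⟫_ℝ) = 0 := by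
    linear_combination -h4
  rw [← sub_eq_zero]
  exact inner_self_eq_zero.1 ((mul_eq_zero.1 h5).resolve_right (mul_ne_zero hu' hv'))

/-- The vector along the image of the segment from `(c.1, 0)` to `(c.2, 1)`. -/
def chordVec (f : ℝ × ℝ → EuclideanSpace ℝ (Fin 3)) (c : ℝ × ℝ) : EuclideanSpace ℝ (Fin 3) :=
  f (c.2, 1) - f (c.1, 0)

/-- The T-pattern of Schwartz: two straight chords whose images lie on perpendicular intersecting
lines. -/
theorem IsPaperMoebius.exists_tPattern {l : ℝ} {f : ℝ × ℝ → EuclideanSpace ℝ (Fin 3)}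
    (hf : IsPaperMoebius l f) : ∃ c ∈ chords f, ∃ d ∈ chords f, c ≤ d ∧ d ≤ (c.2 + l, c.1 + l) ∧
      ⟪chordVec f c, chordVec f d⟫_ℝ = 0 ∧
      ∃ α β : ℝ, f (c.1, 0) + α • chordVec f c = f (d.1, 0) + β • chordVec f d := by
  obtain ⟨c₀, h₀⟩ := hf.chords_nonempty
  obtain ⟨γ, hγc, hγm, hγ0, hγ1, hγK, -⟩ := exists_monotone_curve hf.isClosed_chords
    (fun c hc d hd => hf.exists_mem_chords_between hc hd) h₀ (hf.shift_mem_chords h₀)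
    (hf.le_shift h₀)
  set s₀ := c₀.1 + c₀.2
  set s₁ := (c₀.2 + l, c₀.1 + l).1 + (c₀.2 + l, c₀.1 + l).2
  have hs : s₀ ≤ s₁ := add_le_add (hf.le_shift h₀).1 (hf.le_shift h₀).2
  set u : ℝ → EuclideanSpace ℝ (Fin 3) := fun s => chordVec f (γ s) with hu
  set m : ℝ → EuclideanSpace ℝ (Fin 3) := fun s => f ((γ s).2, 1) + f ((γ s).1, 0) with hm
  have hu0 : ∀ s, u s ≠ 0 := fun s => sub_ne_zero_of_mem_chords (hγK s)
  have hfc := hf.smooth.continuous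
  have huc : Continuous u := by simp only [hu, chordVec]; fun_prop
  have hmc : Continuous m := by fun_prop
  have hu1 : u s₁ = -u s₀ := by
    simp only [hu, chordVec, hγ0, hγ1, hf.apply_add_one, hf.apply_add_zero, neg_sub]
  have hm1 : m s₁ = m s₀ := by
    simp only [hm, hγ0, hγ1, hf.apply_add_one, hf.apply_add_zero]
    exact add_comm _ _
  let F : ℝ × ℝ → ℂ := fun p => ((⟪u p.1, u p.2⟫_ℝ / (‖u p.1‖ * ‖u p.2‖) : ℝ) : ℂ) +
    (triple (m p.1 - m p.2) (u p.1) (u p.2) : ℝ) * Complex.I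
  have hF : Continuous F := by
    have h1 : Continuous fun p : ℝ × ℝ => ⟪u p.1, u p.2⟫_ℝ / (‖u p.1‖ * ‖u p.2‖) :=
      Continuous.div (by fun_prop) (by fun_prop)
        fun p => mul_ne_zero (norm_ne_zero_iff.2 (hu0 _)) (norm_ne_zero_iff.2 (hu0 _))
    have h2 : Continuous fun p : ℝ × ℝ => triple (m p.1 - m p.2) (u p.1) (u p.2) := by
      unfold triple
      fun_prop
    fun_prop
  obtain ⟨s, t, hs0, hst, ht1, hz⟩ := exists_zero_of_antisymmetric_legs hF hs
    (fun s _ => by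
      have h1 := norm_ne_zero_iff.2 (hu0 s)
      have h2 : triple (m s - m s) (u s) (u s) = 0 := by simp [triple]
      simp only [F, real_inner_self_eq_norm_mul_norm, h2]
      rw [div_self (mul_ne_zero h1 h1)]
      simp)
    (fun s _ => by
      have h1 : triple (m s - m s₀) (u s) (-u s₀) = -triple (m s₀ - m s) (u s₀) (u s) := by
        simp only [triple, PiLp.sub_apply, PiLp.neg_apply]
        ring
      simp only [F, hu1, hm1, h1, norm_neg, inner_neg_right]
      rw [real_inner_comm, mul_comm ‖u s‖]
      push_cast
      ring)
  have hre : ⟪u s, u t⟫_ℝ / (‖u s‖ * ‖u t‖) = 0 := by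
    simpa only [F, Complex.add_re, Complex.ofReal_re, Complex.re_ofReal_mul, Complex.I_re,
      mul_zero, add_zero, Complex.zero_re] using congrArg Complex.re hz
  have him : triple (m s - m t) (u s) (u t) = 0 := by
    simpa only [F, Complex.add_im, Complex.ofReal_im, Complex.im_ofReal_mul, Complex.I_im,
      mul_one, zero_add, Complex.zero_im] using congrArg Complex.im hz
  have hperp : ⟪u s, u t⟫_ℝ = 0 := (div_eq_zero_iff.1 hre).resolve_right
    (mul_ne_zero (norm_ne_zero_iff.2 (hu0 _)) (norm_ne_zero_iff.2 (hu0 _)))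
  obtain ⟨p, q, hpq⟩ := exists_eq_smul_add_smul_of_triple_eq_zero (hu0 s) (hu0 t) hperp him
  refine ⟨γ s, hγK s, γ t, hγK t, hγm hst, ?_, hperp, (1 - p) / 2, (1 + q) / 2, ?_⟩
  · have h1 := hγm hs0
    have h2 := hγm ht1
    rw [hγ0] at h1
    rw [hγ1] at h2
    exact h2.trans ⟨add_le_add_left h1.2 l, add_le_add_left h1.1 l⟩
  · have e : ∀ (r : ℝ) (s : ℝ), (2 : ℝ) • (f ((γ s).1, 0) + r • u s) = m s + (2 * r - 1) • u s :=
      fun r s => by simp only [hu, hm, chordVec]; module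
    have h2 : Function.Injective fun x : EuclideanSpace ℝ (Fin 3) => (2 : ℝ) • x :=
      smul_right_injective _ two_ne_zero
    apply h2
    change (2 : ℝ) • (f ((γ s).1, 0) + ((1 - p) / 2) • u s) =
      (2 : ℝ) • (f ((γ t).1, 0) + ((1 + q) / 2) • u t)
    rw [e, e, ← sub_eq_zero,
      show m s + (2 * ((1 - p) / 2) - 1) • u s - (m t + (2 * ((1 + q) / 2) - 1) • u t) =
        (m s - m t) - (p • u s + q • u t) by module, hpq, sub_self]

theorem norm_sq_add_le_sq_norm_add_norm {V : Type*} [NormedAddCommGroup V] [InnerProductSpace ℝ V]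
    {u v : V} (huv : ⟪u, v⟫_ℝ = 0) (α β : ℝ) :
    ‖u‖ ^ 2 + 4 * β ^ 2 * ‖v‖ ^ 2 ≤ (‖α • u - β • v‖ + ‖(1 - α) • u + β • v‖) ^ 2 := by
  have hsq : ∀ p q : ℝ, ‖p • u + q • v‖ ^ 2 = p ^ 2 * ‖u‖ ^ 2 + q ^ 2 * ‖v‖ ^ 2 := fun p q => by
    rw [norm_add_sq_real, inner_smul_left, inner_smul_right, huv, norm_smul, norm_smul, mul_pow,
      mul_pow, Real.norm_eq_abs, Real.norm_eq_abs, sq_abs, sq_abs]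
    simp
  have h1 : ‖(1 - α) • u + β • v‖ = ‖(1 - α) • u - β • v‖ := by
    rw [← sq_eq_sq₀ (norm_nonneg _) (norm_nonneg _), hsq,
      sub_eq_add_neg ((1 - α) • u), ← neg_smul, hsq]
    ring
  have h2 : ‖u - (2 * β) • v‖ ≤ ‖α • u - β • v‖ + ‖(1 - α) • u - β • v‖ := by
    refine le_trans (le_of_eq ?_) (norm_add_le _ _)
    congr 1
    module
  have h3 : ‖u - (2 * β) • v‖ ^ 2 = ‖u‖ ^ 2 + 4 * β ^ 2 * ‖v‖ ^ 2 := by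
    have := hsq 1 (-(2 * β))
    rw [one_smul, neg_smul, ← sub_eq_add_neg] at this
    rw [this]
    ring
  rw [← h3, h1]
  gcongr

theorem sqrt_three_lt_of_perimeter_bounds {l t t' α β : ℝ} (hl : 0 < l)
    (h₁ : 1 + t ^ 2 + 4 * β ^ 2 * (1 + t' ^ 2) ≤ (l + t) ^ 2)
    (h₂ : 1 + t ^ 2 + 4 * (1 - β) ^ 2 * (1 + t' ^ 2) ≤ (l - t) ^ 2)
    (h₃ : 1 + t' ^ 2 + 4 * (1 - α) ^ 2 * (1 + t ^ 2) ≤ (l + t') ^ 2)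
    (h₄ : 1 + t' ^ 2 + 4 * α ^ 2 * (1 + t ^ 2) ≤ (l - t') ^ 2)
    (hα : α ∉ Ioo (0 : ℝ) 1) (hβ : β ∉ Ioo (0 : ℝ) 1) : √3 < l := by
  have hsq : ∀ γ : ℝ, γ ∉ Ioo (0 : ℝ) 1 → 0 ≤ γ * (γ - 1) := fun γ hγ => by
    rcases le_or_gt γ 0 with h | h
    · nlinarith
    · have : 1 ≤ γ := not_lt.1 fun h' => hγ ⟨h, h'⟩
      nlinarith
  rw [Real.sqrt_lt' hl]
  by_contra! hl3
  have hα' := hsq α hα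
  have hβ' := hsq β hβ
  have ht' : t' ^ 2 = 0 ∧ β * (β - 1) = 0 := by
    constructor <;> nlinarith [mul_nonneg hβ' (sq_nonneg t'), sq_nonneg t']
  have ht : t = 0 := by
    have : t ^ 2 = 0 := by nlinarith [mul_nonneg hα' (sq_nonneg t), sq_nonneg t]
    simpa using this
  rw [ht'.1, ht] at h₁ h₂
  nlinarith

theorem sqrt_three_lt_of_notMem_Icc {l t s β : ℝ} (hl : 0 < l)
    (h₁ : 1 + t ^ 2 + 4 * β ^ 2 * (1 + s ^ 2) ≤ (l + t) ^ 2)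
    (h₂ : 1 + t ^ 2 + 4 * (1 - β) ^ 2 * (1 + s ^ 2) ≤ (l - t) ^ 2)
    (hβ : β ∉ Icc (0 : ℝ) 1) : √3 < l := by
  have h : 0 < β * (β - 1) := by
    rcases lt_or_ge β 0 with h | h
    · nlinarith
    · have : 1 < β := not_le.1 fun h' => hβ ⟨h, h'⟩
      nlinarith
  rw [Real.sqrt_lt' hl]
  nlinarith [mul_nonneg h.le (sq_nonneg s), sq_nonneg s]

namespace IsPaperMoebius

variable {l : ℝ} {f : ℝ × ℝ → EuclideanSpace ℝ (Fin 3)} (hf : IsPaperMoebius l f)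

include hf

theorem apply_add_int_mul (n : ℤ) (x : ℝ) {y : ℝ} (hy : y ∈ Icc (0 : ℝ) 1) :
    f (x + n * l, if Even n then y else 1 - y) = f (x, y) := by
  have hper : ∀ m : ℤ, ∀ x, f (x + m * (2 * l), y) = f (x, y) := fun m => by
    have : Function.Periodic (fun x => f (x, y)) (2 * l) := fun x => hf.glue_two x hy
    exact this.int_mul m
  rcases Int.even_or_odd' n with ⟨m, rfl | rfl⟩
  · rw [if_pos (even_two_mul m), ← hper m x]
    congr 2
    push_cast
    ring
  · rw [if_neg (Int.not_even_iff_odd.2 (odd_two_mul_add_one m)), ← hper m x, ← hf.glue _ y hy]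
    congr 2
    push_cast
    ring

/-- Points with the same image differ by a deck transformation. -/
theorem exists_int_of_apply_eq {x x' y y' : ℝ} (hy : y ∈ Icc (0 : ℝ) 1) (hy' : y' ∈ Icc (0 : ℝ) 1)
    (h : f (x, y) = f (x', y')) :
    ∃ k : ℤ, x' = x + k * l ∧ y' = if Even k then y else 1 - y := by
  have hflip : ∀ (n : ℤ) {y : ℝ}, y ∈ Icc (0 : ℝ) 1 →
      (if Even n then y else 1 - y) ∈ Icc (0 : ℝ) 1 := fun n y hy => by
    split_ifs
    exacts [hy, ⟨by linarith [hy.2], by linarith [hy.1]⟩]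
  have hred : ∀ (x : ℝ) {y : ℝ}, y ∈ Icc (0 : ℝ) 1 → ∃ n : ℤ, x + n * l ∈ Ico 0 l ∧
      f (x + n * l, if Even n then y else 1 - y) = f (x, y) := fun x y hy =>
    ⟨-⌊x / l⌋, by
      have h1 := Int.sub_floor_div_mul_nonneg x hf.pos
      have h2 := Int.sub_floor_div_mul_lt x hf.pos
      push_cast
      constructor <;> linarith, hf.apply_add_int_mul _ x hy⟩
  obtain ⟨n, hn, hfn⟩ := hred x hy
  obtain ⟨n', hn', hfn'⟩ := hred x' hy'
  obtain ⟨h1, h2⟩ := hf.inj _ _ _ _ hn hn' (hflip n hy) (hflip n' hy') (by rw [hfn, hfn', h])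
  refine ⟨n - n', by push_cast; linarith, ?_⟩
  simp only [Int.even_sub]
  by_cases e : Even n <;> by_cases e' : Even n' <;> simp [e, e'] at h2 ⊢ <;> linarith

/-- Perpendicular straight chords do not meet inside the band: by injectivity they would coincide up
to a deck transformation. -/
theorem notMem_Ioo_of_tPattern {c d : ℝ × ℝ} (hc : c ∈ chords f) (hd : d ∈ chords f) (hcd : c ≤ d)
    (hdc : d ≤ (c.2 + l, c.1 + l)) (hperp : ⟪chordVec f c, chordVec f d⟫_ℝ = 0) {α β : ℝ}
    (hβ : β ∈ Icc (0 : ℝ) 1)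
    (h : f (c.1, 0) + α • chordVec f c = f (d.1, 0) + β • chordVec f d) : α ∉ Ioo (0 : ℝ) 1 := by
  intro hα
  have hl := hf.pos
  have ht := abs_le.1 (hf.abs_sub_le_of_mem_chords hc)
  have hα' : 0 < 1 - α := by linarith [hα.2]
  have hself : ⟪chordVec f c, chordVec f c⟫_ℝ ≠ 0 :=
    inner_self_ne_zero.2 (sub_ne_zero_of_mem_chords hc)
  have hp1 := hcd.1
  have hp2 := hcd.2
  have hp3 : d.1 ≤ c.2 + l := hdc.1
  have hp4 : d.2 ≤ c.1 + l := hdc.2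
  have hne : d ≠ c := fun e => hself (by rwa [e] at hperp)
  have hshift : chordVec f (c.2 + l, c.1 + l) = -chordVec f c := by
    simp only [chordVec, hf.apply_add_one, hf.apply_add_zero, neg_sub]
  have hne' : d ≠ (c.2 + l, c.1 + l) := fun e => hself (by
    rwa [e, hshift, inner_neg_right, neg_eq_zero] at hperp)
  have hpos : ∀ θ ∈ Ioo (0 : ℝ) 1, 0 < (1 - θ) * (l - (c.2 - c.1)) + θ * (l + (c.2 - c.1)) :=
    fun θ hθ => by
      rcases le_total (c.2 - c.1) 0 with h | h
      · exact add_pos_of_pos_of_nonneg (mul_pos (sub_pos.2 hθ.2) (by linarith))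
          (mul_nonneg hθ.1.le (by linarith))
      · exact add_pos_of_nonneg_of_pos (mul_nonneg (sub_nonneg.2 hθ.2.le) (by linarith))
          (mul_pos hθ.1 (by linarith))
  simp only [chordVec] at h
  rw [← hf.apply_chord hc (Ioo_subset_Icc_self hα), ← hf.apply_chord hd hβ] at h
  obtain ⟨k, hk, hk'⟩ := hf.exists_int_of_apply_eq (Ioo_subset_Icc_self hα) hβ h
  split_ifs at hk' with hev
  · subst hk'
    have e1 : (1 - β) * (d.1 - c.1) + β * (d.2 - c.2) = k * l := by linarith
    have e2 := mul_nonneg hα'.le (sub_nonneg.2 hp1)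
    have e3 := mul_nonneg hα.1.le (sub_nonneg.2 hp2)
    have e4 := mul_nonneg hα'.le (sub_nonneg.2 hp3)
    have e5 := mul_nonneg hα.1.le (sub_nonneg.2 hp4)
    have hlow : (-1 : ℝ) < k := lt_of_mul_lt_mul_right (a := l) (by linarith) hl.le
    have hup : (k : ℝ) < 2 := lt_of_mul_lt_mul_right (a := l) (by linarith [hpos β hα]) hl.le
    have h0 : k = 0 := by
      have : -1 < k := by exact_mod_cast hlow
      have : k < 2 := by exact_mod_cast hup
      obtain ⟨m, rfl⟩ := hev
      omega
    rw [h0, Int.cast_zero, zero_mul] at e1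
    refine hne (Prod.ext ?_ ?_)
    · have := (mul_eq_zero.1 (show (1 - β) * (d.1 - c.1) = 0 by linarith)).resolve_left hα'.ne'
      linarith
    · have := (mul_eq_zero.1 (show β * (d.2 - c.2) = 0 by linarith)).resolve_left hα.1.ne'
      linarith
  · subst hk'
    have e1 : α * (c.2 + l - d.1) + (1 - α) * (c.1 + l - d.2) = l - k * l := by linarith
    have e2 := mul_nonneg hα.1.le (sub_nonneg.2 hp3)
    have e3 := mul_nonneg hα'.le (sub_nonneg.2 hp4)
    have e4 := mul_nonneg hα.1.le (sub_nonneg.2 hp1)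
    have e5 := mul_nonneg hα'.le (sub_nonneg.2 hp2)
    have hlow : (-1 : ℝ) < k := lt_of_mul_lt_mul_right (a := l)
      (by linarith [hpos (1 - α) ⟨hα', by linarith [hα.1]⟩]) hl.le
    have hup : (k : ℝ) < 2 := lt_of_mul_lt_mul_right (a := l) (by linarith) hl.le
    have h1 : k = 1 := by
      have : -1 < k := by exact_mod_cast hlow
      have : k < 2 := by exact_mod_cast hup
      obtain ⟨m, rfl⟩ := Int.not_even_iff_odd.1 hev
      omega
    rw [h1, Int.cast_one, one_mul, sub_self] at e1
    refine hne' (Prod.ext ?_ ?_)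
    · have := (mul_eq_zero.1 (show α * (c.2 + l - d.1) = 0 by linarith)).resolve_left hα.1.ne'
      simp only
      linarith
    · have := (mul_eq_zero.1 (show (1 - α) * (c.1 + l - d.2) = 0 by linarith)).resolve_left hα'.ne'
      simp only
      linarith

theorem sqrt_three_lt : √3 < l := by
  obtain ⟨c, hc, d, hd, hcd, hdc, hperp, α, β, h⟩ := hf.exists_tPattern
  have hp1 := hcd.1
  have hp2 := hcd.2
  have hp3 : d.1 ≤ c.2 + l := hdc.1
  have hp4 : d.2 ≤ c.1 + l := hdc.2
  set t := c.2 - c.1 with ht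
  set t' := d.2 - d.1 with ht'
  have hbdry : ∀ {y : ℝ}, y ∈ Icc (0 : ℝ) 1 → ∀ {x x' : ℝ}, x ≤ x' →
      ‖f (x', y) - f (x, y)‖ ≤ x' - x := fun {y} hy {x x'} hx => by
    have := hf.norm_sub_le (z := (x, y)) (w := (x', y)) hy hy
    simpa [Real.sqrt_sq (sub_nonneg.2 hx)] using this
  have h0 : (0 : ℝ) ∈ Icc (0 : ℝ) 1 := by simp
  have h1 : (1 : ℝ) ∈ Icc (0 : ℝ) 1 := by simp
  have b1 := hbdry h0 hp1
  have b2 := hbdry h0 hp3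
  have b3 := hbdry h1 hp2
  have b4 := hbdry h1 hp4
  rw [hf.apply_add_zero] at b2
  rw [hf.apply_add_one] at b4
  set u := chordVec f c with hu
  set v := chordVec f d with hv
  have hQ : f (c.2, 1) = f (c.1, 0) + u := by rw [hu, chordVec]; abel
  have hS : f (d.2, 1) = f (d.1, 0) + v := by rw [hv, chordVec]; abel
  have hR : f (d.1, 0) = f (c.1, 0) + α • u - β • v := by rw [h]; abel
  have n1 : ‖α • u - β • v‖ ≤ d.1 - c.1 := by
    refine le_of_eq_of_le (congrArg norm ?_) b1; rw [hR]; module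
  have n2 : ‖(1 - α) • u + β • v‖ ≤ c.2 + l - d.1 := by
    refine le_of_eq_of_le (congrArg norm ?_) b2; rw [hQ, hR]; module
  have n3 : ‖(1 - α) • u - (1 - β) • v‖ ≤ d.2 - c.2 := by
    rw [← norm_neg]; refine le_of_eq_of_le (congrArg norm ?_) b3; rw [hQ, hS, hR]; module
  have n4 : ‖α • u + (1 - β) • v‖ ≤ c.1 + l - d.2 := by
    rw [← norm_neg]; refine le_of_eq_of_le (congrArg norm ?_) b4; rw [hS, hR]; module
  have hnu : ‖u‖ ^ 2 = 1 + t ^ 2 := by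
    rw [show ‖u‖ = √(t ^ 2 + 1) from hc, Real.sq_sqrt (by positivity), add_comm]
  have hnv : ‖v‖ ^ 2 = 1 + t' ^ 2 := by
    rw [show ‖v‖ = √(t' ^ 2 + 1) from hd, Real.sq_sqrt (by positivity), add_comm]
  have hperp' : ⟪v, u⟫_ℝ = 0 := by rw [real_inner_comm, hperp]
  have i1 := norm_sq_add_le_sq_norm_add_norm hperp α β
  have i2 := norm_sq_add_le_sq_norm_add_norm hperp (1 - α) (1 - β)
  have i3 := norm_sq_add_le_sq_norm_add_norm hperp' (1 - β) (1 - α)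
  have i4 := norm_sq_add_le_sq_norm_add_norm hperp' β α
  rw [hnu, hnv] at i1 i2
  rw [hnu, hnv] at i3 i4
  rw [sub_sub_cancel] at i2 i3
  rw [norm_sub_rev, add_comm (β • v)] at i3
  rw [norm_sub_rev, add_comm ((1 - β) • v)] at i4
  have j1 : 1 + t ^ 2 + 4 * β ^ 2 * (1 + t' ^ 2) ≤ (l + t) ^ 2 :=
    i1.trans (pow_le_pow_left₀ (by positivity) (by linarith) 2)
  have j2 : 1 + t ^ 2 + 4 * (1 - β) ^ 2 * (1 + t' ^ 2) ≤ (l - t) ^ 2 :=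
    i2.trans (pow_le_pow_left₀ (by positivity) (by linarith) 2)
  have j3 : 1 + t' ^ 2 + 4 * (1 - α) ^ 2 * (1 + t ^ 2) ≤ (l + t') ^ 2 :=
    i3.trans (pow_le_pow_left₀ (by positivity) (by linarith) 2)
  have j4 : 1 + t' ^ 2 + 4 * α ^ 2 * (1 + t ^ 2) ≤ (l - t') ^ 2 :=
    i4.trans (pow_le_pow_left₀ (by positivity) (by linarith) 2)
  by_cases hβ : β ∈ Icc (0 : ℝ) 1
  swap
  · exact sqrt_three_lt_of_notMem_Icc hf.pos j1 j2 hβ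
  by_cases hα : α ∈ Icc (0 : ℝ) 1
  swap
  · refine sqrt_three_lt_of_notMem_Icc (t := -t') (β := α) (s := t) hf.pos ?_ ?_ hα <;>
      linarith [j3, j4]
  have hα' := hf.notMem_Ioo_of_tPattern hc hd hcd hdc hperp hβ h
  refine sqrt_three_lt_of_perimeter_bounds hf.pos j1 j2 j3 j4 hα' fun hβ' => ?_
  have hx := h
  rw [hu, hv] at hx
  simp only [chordVec] at hx
  rw [← hf.apply_chord hc hα, ← hf.apply_chord hd hβ] at hx
  obtain ⟨k, -, hk⟩ := hf.exists_int_of_apply_eq hα hβ hx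
  apply hα'
  split_ifs at hk
  · rwa [← hk]
  · exact ⟨by linarith [hβ'.2], by linarith [hβ'.1]⟩

end IsPaperMoebius

end PaperMoebius

/-- A smooth embedded paper Moebius band of aspect ratio `lam` has `lam > √3`.
The band is encoded by `f : ℝ → ℝ → ℝ³` which is smooth, satisfies the Moebius
identification `f (x + lam) (1 − y) = f x y`, has isometric total derivative
(with respect to the Euclidean norm `√(v₁² + v₂²)` on the domain), and is injective
modulo the identification. -/
theorem aspect_ratio_gt_sqrt_three
    (lam : ℝ) (hlam : 0 < lam)
    (f : ℝ → ℝ → EuclideanSpace ℝ (Fin 3))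
    (hsmooth : ContDiff ℝ (⊤ : ℕ∞) (fun p : ℝ × ℝ => f p.1 p.2))
    (hglue : ∀ x : ℝ, ∀ y ∈ Set.Icc (0 : ℝ) 1, f (x + lam) (1 - y) = f x y)
    (hisom : ∀ p : ℝ × ℝ, p.2 ∈ Set.Icc (0 : ℝ) 1 → ∀ v : ℝ × ℝ,
      ‖fderiv ℝ (fun q : ℝ × ℝ => f q.1 q.2) p v‖ = Real.sqrt (v.1 ^ 2 + v.2 ^ 2))
    (hinj : ∀ x x' y y' : ℝ, x ∈ Set.Ico (0 : ℝ) lam → x' ∈ Set.Ico (0 : ℝ) lam →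
      y ∈ Set.Icc (0 : ℝ) 1 → y' ∈ Set.Icc (0 : ℝ) 1 →
      f x y = f x' y' → x = x' ∧ y = y') :
    lam > Real.sqrt 3 := by
  have hf : PaperMoebius.IsPaperMoebius lam fun q : ℝ × ℝ => f q.1 q.2 :=
    ⟨hlam, hsmooth, hglue, hisom, hinj⟩
  exact hf.sqrt_three_lt
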